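/- Let H = {(x, y) ∈ ℝ² : y > 0} be the upper half-plane equipped with the hyperbolic metric g(x, y) = y⁻² Id₂. Then there exists no map u : H → ℝ³ of class C² satisfying (∇u(p))ᵀ ∇u(p) = g(p) for all p ∈ H; that is, the full hyperbolic plane admits no C² isometric immersion in ℝ³. (Hilbert's theorem.) -/

import Mathlib

noncomputable section
open Matrix Set

abbrev E2 := EuclideanSpace ℝ (Fin 2)

/-- The Jacobian matrix (3×2) of a map `u : ℝ² → ℝ³` at a point `x`. -/
def Jac (u : E2 → EuclideanSpace ℝ (Fin 3)) (x : E2) : Matrix (Fin 3) (Fin 2) ℝ :=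
  Matrix.of fun i j => fderiv ℝ u x (EuclideanSpace.single j 1) i

/-- The upper half-plane `H = {(x, y) ∈ ℝ² : y > 0}`. -/
def upperHalfPlane : Set E2 := {p : E2 | 0 < p 1}

/-- The hyperbolic metric `g(x, y) = y⁻² Id₂` on the upper half-plane. -/
def hyperbolicMetric (p : E2) : Matrix (Fin 2) (Fin 2) ℝ :=
  ((p 1) ^ 2)⁻¹ • (1 : Matrix (Fin 2) (Fin 2) ℝ)

open Filter Topology MeasureTheory intervalIntegral

section Calculus

variable {E F G : Type*} [NormedAddCommGroup E] [NormedSpace ℝ E]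
  [NormedAddCommGroup F] [NormedSpace ℝ F] [NormedAddCommGroup G] [NormedSpace ℝ G]

/-- The first partial derivative of a function of two real variables. -/
def d1 (f : ℝ × ℝ → F) (z : ℝ × ℝ) : F := fderiv ℝ f z (1, 0)

/-- The second partial derivative of a function of two real variables. -/
def d2 (f : ℝ × ℝ → F) (z : ℝ × ℝ) : F := fderiv ℝ f z (0, 1)

theorem clm_prod_apply (L : ℝ × ℝ →L[ℝ] F) (w : ℝ × ℝ) :
    L w = w.1 • L (1, 0) + w.2 • L (0, 1) := by
  rw [← L.map_smul, ← L.map_smul, ← L.map_add]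
  simp

theorem HasFDerivAt.hasDerivAt_fst {f : ℝ × ℝ → F} {L : ℝ × ℝ →L[ℝ] F} {x y : ℝ}
    (h : HasFDerivAt f L (x, y)) : HasDerivAt (fun x => f (x, y)) (L (1, 0)) x :=
  h.comp_hasDerivAt x ((hasDerivAt_id x).prodMk (hasDerivAt_const x y))

theorem HasFDerivAt.hasDerivAt_snd {f : ℝ × ℝ → F} {L : ℝ × ℝ →L[ℝ] F} {x y : ℝ}
    (h : HasFDerivAt f L (x, y)) : HasDerivAt (fun y => f (x, y)) (L (0, 1)) y :=
  h.comp_hasDerivAt y ((hasDerivAt_const y x).prodMk (hasDerivAt_id y))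

theorem ContDiff.hasFDerivAt_one {f : E → F} (hf : ContDiff ℝ 1 f) (z : E) :
    HasFDerivAt f (fderiv ℝ f z) z :=
  (hf.differentiable one_ne_zero z).hasFDerivAt

theorem ContDiff.hasDerivAt_d1 {f : ℝ × ℝ → F} (hf : ContDiff ℝ 1 f) (x y : ℝ) :
    HasDerivAt (fun x => f (x, y)) (d1 f (x, y)) x :=
  (hf.hasFDerivAt_one _).hasDerivAt_fst

theorem ContDiff.hasDerivAt_d2 {f : ℝ × ℝ → F} (hf : ContDiff ℝ 1 f) (x y : ℝ) :
    HasDerivAt (fun y => f (x, y)) (d2 f (x, y)) y :=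
  (hf.hasFDerivAt_one _).hasDerivAt_snd

theorem ContDiff.continuous_d1 {f : ℝ × ℝ → F} (hf : ContDiff ℝ 1 f) : Continuous (d1 f) :=
  (hf.continuous_fderiv one_ne_zero).clm_apply continuous_const

theorem ContDiff.continuous_d2 {f : ℝ × ℝ → F} (hf : ContDiff ℝ 1 f) : Continuous (d2 f) :=
  (hf.continuous_fderiv one_ne_zero).clm_apply continuous_const

theorem contDiff_one_of_hasFDerivAt {f : E → F} {f' : E → E →L[ℝ] F}
    (h : ∀ z, HasFDerivAt f (f' z) z) (hc : Continuous f') : ContDiff ℝ 1 f := by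
  rw [contDiff_one_iff_fderiv]
  exact ⟨fun z => (h z).differentiableAt, by rwa [funext fun z => (h z).fderiv]⟩

/-- The linear map on `ℝ × ℝ` with prescribed values on the coordinate vectors. -/
def covec (p q : F) : ℝ × ℝ →L[ℝ] F :=
  (ContinuousLinearMap.toSpanSingleton ℝ p).coprod (ContinuousLinearMap.toSpanSingleton ℝ q)

@[simp]
theorem covec_apply (p q : F) (w : ℝ × ℝ) : covec p q w = w.1 • p + w.2 • q := by
  simp [covec]

theorem covec_eq (L : ℝ × ℝ →L[ℝ] F) : covec (L (1, 0)) (L (0, 1)) = L := by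
  ext <;> simp

theorem Continuous.covec {X : Type*} [TopologicalSpace X] {p q : X → F} (hp : Continuous p)
    (hq : Continuous q) : Continuous fun x => covec (p x) (q x) := by
  have e : (fun x => _root_.covec (p x) (q x)) = fun x =>
      ((ContinuousLinearMap.toSpanSingletonCLE (𝕜 := ℝ) (E := F) (p x)).comp
        (ContinuousLinearMap.fst ℝ ℝ ℝ)) +
      ((ContinuousLinearMap.toSpanSingletonCLE (𝕜 := ℝ) (E := F) (q x)).comp
        (ContinuousLinearMap.snd ℝ ℝ ℝ)) := by
    funext x
    ext <;> simp
  rw [e]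
  fun_prop

/-- A function with continuous partial derivatives near a point is differentiable there. -/
theorem hasFDerivAt_of_partial {f p q : ℝ × ℝ → F} {z : ℝ × ℝ}
    (h1 : ∀ᶠ w in 𝓝 z, HasDerivAt (fun x => f (x, w.2)) (p w) w.1)
    (h2 : ∀ᶠ w in 𝓝 z, HasDerivAt (fun y => f (w.1, y)) (q w) w.2)
    (hp : Continuous p) (hq : Continuous q) : HasFDerivAt f (covec (p z) (q z)) z := by
  have key := hasStrictFDerivAt_uncurry_coprod (𝕜 := ℝ) (u := z) (f := fun x y => f (x, y))
    (f₁ := fun x y => ContinuousLinearMap.toSpanSingletonCLE (𝕜 := ℝ) (E := F) (p (x, y)))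
    (f₂ := fun x y => ContinuousLinearMap.toSpanSingletonCLE (𝕜 := ℝ) (E := F) (q (x, y)))
    (h1.mono fun w hw => hw.hasFDerivAt)
    (h2.mono fun w hw => hw.hasFDerivAt)
    (Continuous.continuousAt (by simp only [Function.HasUncurry.uncurry]; fun_prop))
    (Continuous.continuousAt (by simp only [Function.HasUncurry.uncurry]; fun_prop))
  exact key.hasFDerivAt

theorem integral_swap_of_continuous {f : ℝ → ℝ → F} (hf : Continuous f.uncurry) (a b c d : ℝ) :
    ∫ x in a..b, ∫ y in c..d, f x y = ∫ y in c..d, ∫ x in a..b, f x y := by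
  apply intervalIntegral_intervalIntegral_swap
  refine (hf.continuousOn.integrableOn_compact
    (isCompact_uIcc.prod isCompact_uIcc : IsCompact (uIcc a b ×ˢ uIcc c d))).mono_set ?_
  exact prod_mono uIoc_subset_uIcc uIoc_subset_uIcc

/-- Differentiation under the integral sign for continuously differentiable integrands. -/
theorem hasDerivAt_integral_param [CompleteSpace F] {f f' : ℝ → ℝ → F} (hf : Continuous f.uncurry)
    (hf' : Continuous f'.uncurry) (h : ∀ y x, HasDerivAt (fun y => f y x) (f' y x) y)
    (a b y : ℝ) :
    HasDerivAt (fun y => ∫ x in a..b, f y x) (∫ x in a..b, f' y x) y := by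
  have e : (fun y => ∫ x in a..b, f y x) =
      fun y => (∫ x in a..b, f 0 x) + ∫ t in (0 : ℝ)..y, ∫ x in a..b, f' t x := by
    funext y
    rw [integral_swap_of_continuous hf', ← intervalIntegral.integral_add]
    · congr 1
      funext x
      rw [integral_eq_sub_of_hasDerivAt (fun t _ => h t x)]
      · abel
      · exact (Continuous.intervalIntegrable (by fun_prop) _ _)
    · exact (Continuous.intervalIntegrable (by fun_prop) _ _)
    · refine (Continuous.intervalIntegrable ?_ _ _)
      exact continuous_parametric_intervalIntegral_of_continuous'
        (f := fun x t => f' t x) (hf'.comp continuous_swap) _ _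
  rw [e]
  refine HasDerivAt.const_add _ ?_
  exact (continuous_parametric_intervalIntegral_of_continuous' hf' a b).integral_hasStrictDerivAt
    0 y |>.hasDerivAt

variable (B : E →L[ℝ] F →L[ℝ] G)

/-- Green's formula, in differential form, for the one-form `B f dg` with `f` and `g`
continuously differentiable. -/
theorem hasDerivAt_integral_bilin_d1 [CompleteSpace G] {f : ℝ × ℝ → E} {g : ℝ × ℝ → F}
    (hf : ContDiff ℝ 1 f) (hg : ContDiff ℝ 1 g) (a b y : ℝ) :
    HasDerivAt (fun y => ∫ x in a..b, B (f (x, y)) (d1 g (x, y)))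
      ((∫ x in a..b, (B (d2 f (x, y)) (d1 g (x, y)) - B (d1 f (x, y)) (d2 g (x, y)))) +
        (B (f (b, y)) (d2 g (b, y)) - B (f (a, y)) (d2 g (a, y)))) y := by
  have cf := hf.continuous
  have cg := hg.continuous
  have cf1 := hf.continuous_d1
  have cf2 := hf.continuous_d2
  have cg1 := hg.continuous_d1
  have cg2 := hg.continuous_d2
  let K : ℝ × ℝ → G := fun w => ∫ x in a..b, B (f (x, w.1)) (d1 g (x, w.2))
  let K1 : ℝ × ℝ → G := fun w => ∫ x in a..b, B (d2 f (x, w.1)) (d1 g (x, w.2))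
  let K2 : ℝ × ℝ → G := fun w => (B (f (b, w.1)) (d2 g (b, w.2)) - B (f (a, w.1)) (d2 g (a, w.2)))
    - ∫ x in a..b, B (d1 f (x, w.1)) (d2 g (x, w.2))
  have hK1 : ∀ w, HasDerivAt (fun s => K (s, w.2)) (K1 w) w.1 := by
    intro w
    refine hasDerivAt_integral_param (f := fun s x => B (f (x, s)) (d1 g (x, w.2)))
      (f' := fun s x => B (d2 f (x, s)) (d1 g (x, w.2))) ?_ ?_ ?_ a b w.1
    · simp only [Function.uncurry_def]; fun_prop
    · simp only [Function.uncurry_def]; fun_prop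
    · intro s x
      have := ((B.flip (d1 g (x, w.2))).hasFDerivAt (x := f (x, s))).comp_hasDerivAt s
        (hf.hasDerivAt_d2 x s)
      simpa using! this
  have parts : ∀ s t, K (s, t) = (B (f (b, s)) (g (b, t)) - B (f (a, s)) (g (a, t)))
      - ∫ x in a..b, B (d1 f (x, s)) (g (x, t)) := by
    intro s t
    rw [← integral_eq_sub_of_hasDerivAt (f := fun x => B (f (x, s)) (g (x, t)))
      (fun x _ => B.hasDerivAt_of_bilinear (fun _ => hf.hasDerivAt_d1 x s)
        (fun _ => hg.hasDerivAt_d1 x t)), ← intervalIntegral.integral_sub]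
    · simp [K]
    · exact Continuous.intervalIntegrable (by fun_prop) _ _
    · exact Continuous.intervalIntegrable (by fun_prop) _ _
    · exact Continuous.intervalIntegrable (by fun_prop) _ _
  have hK2 : ∀ w, HasDerivAt (fun t => K (w.1, t)) (K2 w) w.2 := by
    intro w
    simp only [parts]
    refine HasDerivAt.sub (HasDerivAt.sub ?_ ?_) ?_
    · exact (B (f (b, w.1))).hasFDerivAt.comp_hasDerivAt _ (hg.hasDerivAt_d2 b w.2)
    · exact (B (f (a, w.1))).hasFDerivAt.comp_hasDerivAt _ (hg.hasDerivAt_d2 a w.2)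
    · refine hasDerivAt_integral_param (f := fun t x => B (d1 f (x, w.1)) (g (x, t)))
        (f' := fun t x => B (d1 f (x, w.1)) (d2 g (x, t))) ?_ ?_ ?_ a b w.2
      · simp only [Function.uncurry_def]; fun_prop
      · simp only [Function.uncurry_def]; fun_prop
      · intro t x
        exact (B (d1 f (x, w.1))).hasFDerivAt.comp_hasDerivAt _ (hg.hasDerivAt_d2 x t)
  have cK1 : Continuous K1 := by
    refine continuous_parametric_intervalIntegral_of_continuous'
      (f := fun (w : ℝ × ℝ) x => B (d2 f (x, w.1)) (d1 g (x, w.2))) ?_ _ _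
    simp only [Function.uncurry_def]; fun_prop
  have cK2 : Continuous K2 := by
    refine Continuous.sub (by fun_prop) (continuous_parametric_intervalIntegral_of_continuous'
      (f := fun (w : ℝ × ℝ) x => B (d1 f (x, w.1)) (d2 g (x, w.2))) ?_ _ _)
    simp only [Function.uncurry_def]; fun_prop
  have hK := hasFDerivAt_of_partial (z := (y, y)) (Eventually.of_forall hK1)
    (Eventually.of_forall hK2) cK1 cK2
  have := HasFDerivAt.comp_hasDerivAt (f := fun y : ℝ => (y, y)) y hK
    ((hasDerivAt_id y).prodMk (hasDerivAt_id y))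
  refine (this.congr_deriv ?_)
  rw [intervalIntegral.integral_sub]
  · simp [K1, K2]
    abel
  · exact Continuous.intervalIntegrable (by fun_prop) _ _
  · exact Continuous.intervalIntegrable (by fun_prop) _ _

end Calculus

section SineGordon

/-- Auxiliary form of the nonexistence theorem for global solutions of the sine-Gordon equation with
values in `(0, π)`: the solution cannot increase along the first variable. -/
theorem sineGordon_antitone {ω : ℝ × ℝ → ℝ} (hω : Continuous ω)
    (h0 : ∀ z, 0 < ω z) (hπ : ∀ z, ω z < Real.pi)
    (h : ∀ s₁ s₂ t₁ t₂, ω (s₂, t₂) - ω (s₁, t₂) - ω (s₂, t₁) + ω (s₁, t₁) =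
      ∫ s in s₁..s₂, ∫ t in t₁..t₂, Real.sin (ω (s, t)))
    {s₀ s₁ : ℝ} (hs : s₀ ≤ s₁) (t₀ : ℝ) : ω (s₁, t₀) ≤ ω (s₀, t₀) := by
  by_contra! hlt
  have hsin : ∀ z, 0 ≤ Real.sin (ω z) := fun z =>
    Real.sin_nonneg_of_nonneg_of_le_pi (h0 z).le (hπ z).le
  have mixed_nonneg : ∀ {a b t₁ t₂ : ℝ}, a ≤ b → t₁ ≤ t₂ →
      0 ≤ ω (b, t₂) - ω (a, t₂) - ω (b, t₁) + ω (a, t₁) := by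
    intro a b t₁ t₂ hab ht
    rw [h]
    exact integral_nonneg hab fun s _ => integral_nonneg ht fun t _ => hsin _
  set δ := (ω (s₁, t₀) - ω (s₀, t₀)) / 4 with hδ
  have hδpos : 0 < δ := by rw [hδ]; linarith
  have cg : Continuous fun s => ω (s, t₀) := by fun_prop
  obtain ⟨c, hc, hgc⟩ : (ω (s₀, t₀) + ω (s₁, t₀)) / 2 ∈ (fun s => ω (s, t₀)) '' Icc s₀ s₁ :=
    intermediate_value_Icc hs cg.continuousOn ⟨by linarith, by linarith⟩
  simp only at hgc
  have hcs1 : c < s₁ := by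
    refine lt_of_le_of_ne hc.2 fun he => ?_
    rw [he] at hgc
    linarith
  obtain ⟨ε, hε, hball⟩ := Metric.continuousAt_iff.1 (cg.continuousAt (x := c)) δ hδpos
  set b := min s₁ (c + ε / 2) with hb
  have hcb : c < b := lt_min hcs1 (by linarith)
  have hbs : b ≤ s₁ := min_le_left _ _
  have hbe : b ≤ c + ε / 2 := min_le_right _ _
  have hmid : ∀ s ∈ Icc c b, |ω (s, t₀) - ω (c, t₀)| < δ := by
    intro s hs'
    have := hball (x := s) (by
      rw [Real.dist_eq, abs_lt]; constructor <;> linarith [hs'.1, hs'.2])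
    rwa [Real.dist_eq] at this
  have hδπ : δ < Real.pi / 2 := by
    have := hπ (s₁, t₀)
    have := h0 (s₀, t₀)
    have := Real.pi_pos
    rw [hδ]; linarith
  have hlow : ∀ s ∈ Icc c b, ∀ t, t₀ ≤ t → Real.sin δ ≤ Real.sin (ω (s, t)) := by
    intro s hs' t ht
    have hm := abs_lt.1 (hmid s hs')
    have h1 := mixed_nonneg (hc.1.trans hs'.1) ht
    have h2 := mixed_nonneg (hs'.2.trans hbs) ht
    have l1 : δ ≤ ω (s, t) := by have := h0 (s₀, t); linarith
    have l2 : ω (s, t) ≤ Real.pi - δ := by have := hπ (s₁, t); linarith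
    rcases le_total (ω (s, t)) (Real.pi / 2) with hh | hh
    · exact Real.sin_le_sin_of_le_of_le_pi_div_two (by linarith) hh l1
    · rw [← Real.sin_pi_sub (ω (s, t))]
      exact Real.sin_le_sin_of_le_of_le_pi_div_two (by linarith) (by linarith) (by linarith)
  have hsδ : 0 < Real.sin δ :=
    Real.sin_pos_of_pos_of_lt_pi hδpos (by linarith [Real.pi_pos])
  have hgrow : ∀ T, 0 ≤ T → (b - c) * (T * Real.sin δ) ≤ 2 * Real.pi := by
    intro T hT
    have hi : (b - c) * (T * Real.sin δ) ≤
        ∫ s in c..b, ∫ t in t₀..(t₀ + T), Real.sin (ω (s, t)) := by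
      have e : (b - c) * (T * Real.sin δ) = ∫ s in c..b, ∫ t in t₀..(t₀ + T), Real.sin δ := by
        simp
        ring
      rw [e]
      refine integral_mono_on hcb.le (by simp) ?_ fun s hs' => ?_
      · exact Continuous.intervalIntegrable (by fun_prop) _ _
      · refine integral_mono_on (by linarith) (by simp) ?_ fun t ht => hlow s hs' t ht.1
        exact Continuous.intervalIntegrable (by fun_prop) _ _
    rw [← h] at hi
    linarith [h0 (c, t₀ + T), h0 (b, t₀), hπ (b, t₀ + T), hπ (c, t₀)]
  have hpos : 0 < (b - c) * Real.sin δ := mul_pos (by linarith) hsδ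
  have := hgrow ((2 * Real.pi + 1) / ((b - c) * Real.sin δ))
    (div_nonneg (by linarith [Real.pi_pos]) hpos.le)
  have e : (b - c) * ((2 * Real.pi + 1) / ((b - c) * Real.sin δ) * Real.sin δ) =
      2 * Real.pi + 1 := by
    have := hsδ.ne'
    have : b - c ≠ 0 := by linarith
    field_simp
  linarith

/-- The sine-Gordon equation `ω_st = sin ω`, in integrated form, has no solution on the plane with
values in `(0, π)`. -/
theorem no_global_sineGordon {ω : ℝ × ℝ → ℝ} (hω : Continuous ω)
    (h0 : ∀ z, 0 < ω z) (hπ : ∀ z, ω z < Real.pi)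
    (h : ∀ s₁ s₂ t₁ t₂, ω (s₂, t₂) - ω (s₁, t₂) - ω (s₂, t₁) + ω (s₁, t₁) =
      ∫ s in s₁..s₂, ∫ t in t₁..t₂, Real.sin (ω (s, t))) : False := by
  have h' : ∀ s₁ s₂ t₁ t₂, ω (-s₂, -t₂) - ω (-s₁, -t₂) - ω (-s₂, -t₁) + ω (-s₁, -t₁) =
      ∫ s in s₁..s₂, ∫ t in t₁..t₂, Real.sin (ω (-s, -t)) := by
    intro s₁ s₂ t₁ t₂
    have e : ∀ s, ∫ t in t₁..t₂, Real.sin (ω (-s, -t)) = ∫ t in -t₂..-t₁, Real.sin (ω (-s, t)) :=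
      fun s => integral_comp_neg fun t => Real.sin (ω (-s, t))
    simp only [e]
    rw [integral_comp_neg fun s => ∫ t in -t₂..-t₁, Real.sin (ω (s, t)), ← h]
    ring
  have hconst : ∀ s₀ s₁ t, s₀ ≤ s₁ → ω (s₁, t) = ω (s₀, t) := by
    intro s₀ s₁ t hs
    refine le_antisymm (sineGordon_antitone hω h0 hπ h hs t) ?_
    have := sineGordon_antitone (ω := fun z => ω (-z.1, -z.2)) (by fun_prop) (fun z => h0 _)
      (fun z => hπ _) h' (neg_le_neg hs) (-t)
    simpa using this
  have := h 0 1 0 1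
  rw [hconst 0 1 1 zero_le_one, hconst 0 1 0 zero_le_one] at this
  have hpos : 0 < ∫ s in (0 : ℝ)..1, ∫ t in (0 : ℝ)..1, Real.sin (ω (s, t)) := by
    refine intervalIntegral_pos_of_pos (Continuous.intervalIntegrable (by fun_prop) _ _)
      (fun s => ?_) zero_lt_one
    exact intervalIntegral_pos_of_pos (Continuous.intervalIntegrable (by fun_prop) _ _)
      (fun t => Real.sin_pos_of_pos_of_lt_pi (h0 _) (hπ _)) zero_lt_one
  linarith

/-- The system satisfied by the direction angles of the coordinate lines of an asymptotic Chebyshev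
net has no global solution. -/
theorem no_global_chebyshev_angles {α β : ℝ × ℝ → ℝ} (hα : Continuous α) (hβ : Continuous β)
    (hα' : ∀ s t, HasDerivAt (fun t => α (s, t)) (-Real.cos (β (s, t))) t)
    (hβ' : ∀ s t, HasDerivAt (fun s => β (s, t)) (-Real.cos (α (s, t))) s)
    (h0 : ∀ z, 0 < β z - α z) (hπ : ∀ z, β z - α z < Real.pi) : False := by
  refine no_global_sineGordon (ω := fun z => β z - α z) (by fun_prop) h0 hπ ?_
  intro s₁ s₂ t₁ t₂
  have hαi : ∀ s, α (s, t₂) - α (s, t₁) = ∫ t in t₁..t₂, -Real.cos (β (s, t)) := fun s =>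
    (integral_eq_sub_of_hasDerivAt (fun t _ => hα' s t)
      (Continuous.intervalIntegrable (by fun_prop) _ _)).symm
  have hβi : ∀ t, β (s₂, t) - β (s₁, t) = ∫ s in s₁..s₂, -Real.cos (α (s, t)) := fun t =>
    (integral_eq_sub_of_hasDerivAt (fun s _ => hβ' s t)
      (Continuous.intervalIntegrable (by fun_prop) _ _)).symm
  have hcα : ∀ s, -Real.cos (α (s, t₂)) - -Real.cos (α (s, t₁)) =
      ∫ t in t₁..t₂, -(Real.sin (α (s, t)) * Real.cos (β (s, t))) := by
    intro s
    refine (integral_eq_sub_of_hasDerivAt (f := fun t => -Real.cos (α (s, t)))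
      (f' := fun t => -(Real.sin (α (s, t)) * Real.cos (β (s, t)))) (fun t _ => ?_)
      (Continuous.intervalIntegrable (by fun_prop) _ _)).symm
    exact ((hα' s t).cos.neg).congr_deriv (by ring)
  have hcβ : ∀ t, -Real.cos (β (s₂, t)) - -Real.cos (β (s₁, t)) =
      ∫ s in s₁..s₂, -(Real.sin (β (s, t)) * Real.cos (α (s, t))) := by
    intro t
    refine (integral_eq_sub_of_hasDerivAt (f := fun s => -Real.cos (β (s, t)))
      (f' := fun s => -(Real.sin (β (s, t)) * Real.cos (α (s, t)))) (fun s _ => ?_)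
      (Continuous.intervalIntegrable (by fun_prop) _ _)).symm
    exact ((hβ' s t).cos.neg).congr_deriv (by ring)
  have e1 : (β (s₂, t₂) - β (s₁, t₂)) - (β (s₂, t₁) - β (s₁, t₁)) =
      ∫ s in s₁..s₂, ∫ t in t₁..t₂, -(Real.sin (α (s, t)) * Real.cos (β (s, t))) := by
    rw [hβi, hβi, ← integral_sub (Continuous.intervalIntegrable (by fun_prop) _ _)
      (Continuous.intervalIntegrable (by fun_prop) _ _)]
    simp only [hcα]
  have e2 : (α (s₂, t₂) - α (s₂, t₁)) - (α (s₁, t₂) - α (s₁, t₁)) =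
      ∫ s in s₁..s₂, ∫ t in t₁..t₂, -(Real.sin (β (s, t)) * Real.cos (α (s, t))) := by
    rw [hαi, hαi, ← integral_sub (Continuous.intervalIntegrable (by fun_prop) _ _)
      (Continuous.intervalIntegrable (by fun_prop) _ _)]
    simp only [hcβ]
    exact integral_swap_of_continuous
      (f := fun t s => -(Real.sin (β (s, t)) * Real.cos (α (s, t))))
      (by simp only [Function.uncurry_def]; fun_prop) _ _ _ _
  have e3 : ∀ s, ∫ t in t₁..t₂, Real.sin (β (s, t) - α (s, t)) =
      (∫ t in t₁..t₂, -(Real.sin (α (s, t)) * Real.cos (β (s, t)))) -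
        ∫ t in t₁..t₂, -(Real.sin (β (s, t)) * Real.cos (α (s, t))) := by
    intro s
    rw [← integral_sub (Continuous.intervalIntegrable (by fun_prop) _ _)
      (Continuous.intervalIntegrable (by fun_prop) _ _)]
    congr 1
    funext t
    rw [Real.sin_sub]
    ring
  simp only [e3]
  rw [integral_sub (Continuous.intervalIntegrable (by fun_prop) _ _)
    (Continuous.intervalIntegrable (by fun_prop) _ _), ← e1, ← e2]
  ring

end SineGordon

section Primitive

/-- The defect of closedness of the one-form `p dx + q dy` on a rectangle. -/
def rectDefect (p q : ℝ × ℝ → ℝ) (x₁ x₂ y₁ y₂ : ℝ) : ℝ :=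
  ((∫ x in x₁..x₂, p (x, y₂)) - ∫ x in x₁..x₂, p (x, y₁)) -
    ((∫ y in y₁..y₂, q (x₂, y)) - ∫ y in y₁..y₂, q (x₁, y))

variable {p q : ℝ × ℝ → ℝ}

theorem rectDefect_add_fst (hp : Continuous p) (x₁ x₂ x₃ y₁ y₂ : ℝ) :
    rectDefect p q x₁ x₂ y₁ y₂ + rectDefect p q x₂ x₃ y₁ y₂ = rectDefect p q x₁ x₃ y₁ y₂ := by
  have h : ∀ y, (∫ x in x₁..x₂, p (x, y)) + ∫ x in x₂..x₃, p (x, y) = ∫ x in x₁..x₃, p (x, y) :=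
    fun y => integral_add_adjacent_intervals (Continuous.intervalIntegrable (by fun_prop) _ _)
      (Continuous.intervalIntegrable (by fun_prop) _ _)
  simp only [rectDefect, ← h]
  ring

theorem rectDefect_add_snd (hq : Continuous q) (x₁ x₂ y₁ y₂ y₃ : ℝ) :
    rectDefect p q x₁ x₂ y₁ y₂ + rectDefect p q x₁ x₂ y₂ y₃ = rectDefect p q x₁ x₂ y₁ y₃ := by
  have h : ∀ x, (∫ y in y₁..y₂, q (x, y)) + ∫ y in y₂..y₃, q (x, y) = ∫ y in y₁..y₃, q (x, y) :=
    fun x => integral_add_adjacent_intervals (Continuous.intervalIntegrable (by fun_prop) _ _)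
      (Continuous.intervalIntegrable (by fun_prop) _ _)
  simp only [rectDefect, ← h]
  ring

/-- A continuous one-form that is closed in the integral sense has a primitive. -/
theorem exists_primitive_of_rectDefect (hp : Continuous p) (hq : Continuous q)
    {I J : Set ℝ} (hI : IsOpen I) (hJ : IsOpen J) (x₀ y₀ : ℝ)
    (h : ∀ x ∈ I, ∀ y ∈ J, rectDefect p q x₀ x y₀ y = 0) :
    ∃ s : ℝ × ℝ → ℝ, ∀ z ∈ I ×ˢ J, HasFDerivAt s (covec (p z) (q z)) z := by
  refine ⟨fun z => (∫ x in x₀..z.1, p (x, y₀)) + ∫ y in y₀..z.2, q (z.1, y), fun z hz => ?_⟩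
  have hnhds : I ×ˢ J ∈ 𝓝 z := (hI.prod hJ).mem_nhds hz
  refine hasFDerivAt_of_partial (p := p) (q := q) (z := z)
    (f := fun z => (∫ x in x₀..z.1, p (x, y₀)) + ∫ y in y₀..z.2, q (z.1, y)) ?_ ?_ hp hq
  · filter_upwards [hnhds] with w hw
    have : (fun x => (∫ x in x₀..x, p (x, y₀)) + ∫ y in y₀..w.2, q (x, y)) =ᶠ[𝓝 w.1]
        fun x => (∫ x in x₀..x, p (x, w.2)) + ∫ y in y₀..w.2, q (x₀, y) := by
      filter_upwards [hI.mem_nhds hw.1] with x hx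
      have := h x hx w.2 hw.2
      simp only [rectDefect] at this
      linarith
    refine HasDerivAt.congr_of_eventuallyEq ?_ this
    refine HasDerivAt.add_const (∫ y in y₀..w.2, q (x₀, y)) ?_
    exact (Continuous.integral_hasStrictDerivAt (f := fun x => p (x, w.2)) (by fun_prop)
      x₀ w.1).hasDerivAt
  · refine Eventually.of_forall fun w => ?_
    refine HasDerivAt.const_add (∫ x in x₀..w.1, p (x, y₀)) ?_
    exact (Continuous.integral_hasStrictDerivAt (f := fun y => q (w.1, y)) (by fun_prop)
      y₀ w.2).hasDerivAt

theorem rectDefect_eq_zero_of_primitive (hp : Continuous p) (hq : Continuous q)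
    {s : ℝ × ℝ → ℝ} {U : Set (ℝ × ℝ)}
    (h : ∀ z ∈ U, HasFDerivAt s (covec (p z) (q z)) z) {x₁ x₂ y₁ y₂ : ℝ}
    (hU : uIcc x₁ x₂ ×ˢ uIcc y₁ y₂ ⊆ U) : rectDefect p q x₁ x₂ y₁ y₂ = 0 := by
  have hx : ∀ y ∈ uIcc y₁ y₂, ∫ x in x₁..x₂, p (x, y) = s (x₂, y) - s (x₁, y) := by
    intro y hy
    refine integral_eq_sub_of_hasDerivAt (f := fun x => s (x, y)) (fun x hx => ?_)
      (Continuous.intervalIntegrable (by fun_prop) _ _)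
    simpa using (h (x, y) (hU ⟨hx, hy⟩)).hasDerivAt_fst
  have hy : ∀ x ∈ uIcc x₁ x₂, ∫ y in y₁..y₂, q (x, y) = s (x, y₂) - s (x, y₁) := by
    intro x hx
    refine integral_eq_sub_of_hasDerivAt (f := fun y => s (x, y)) (fun y hy => ?_)
      (Continuous.intervalIntegrable (by fun_prop) _ _)
    simpa using (h (x, y) (hU ⟨hx, hy⟩)).hasDerivAt_snd
  rw [rectDefect, hx _ right_mem_uIcc, hx _ left_mem_uIcc, hy _ right_mem_uIcc,
    hy _ left_mem_uIcc]
  ring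

/-- A continuous one-form on the plane that has local primitives has a global primitive. -/
theorem exists_global_primitive (hp : Continuous p) (hq : Continuous q)
    (h : ∀ z, ∃ s : ℝ × ℝ → ℝ, ∀ᶠ w in 𝓝 z, HasFDerivAt s (covec (p w) (q w)) w) :
    ∃ s : ℝ × ℝ → ℝ, ∀ z, HasFDerivAt s (covec (p z) (q z)) z := by
  suffices hR : ∀ x y, rectDefect p q 0 x 0 y = 0 by
    obtain ⟨s, hs⟩ := exists_primitive_of_rectDefect hp hq isOpen_univ isOpen_univ
      0 0 fun x _ y _ => hR x y
    exact ⟨s, fun z => hs z (by simp)⟩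
  intro x y
  set n := max |x| |y| with hn
  have hn0 : 0 ≤ n := (abs_nonneg x).trans (le_max_left _ _)
  have hxn : x ∈ Icc (-n) n := abs_le.1 (le_max_left _ _)
  have hyn : y ∈ Icc (-n) n := abs_le.1 (le_max_right _ _)
  choose s hs using h
  obtain ⟨δ, hδ, hcov⟩ := lebesgue_number_lemma_of_metric
    (s := Icc (-n) n ×ˢ Icc (-n) n)
    (c := fun z => interior {w | HasFDerivAt (s z) (covec (p w) (q w)) w})
    (isCompact_Icc.prod isCompact_Icc) (fun _ => isOpen_interior)
    (fun z _ => mem_iUnion.2 ⟨z, mem_interior_iff_mem_nhds.2 (hs z)⟩)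
  have small : ∀ x₁ ∈ Icc (-n) n, ∀ y₁ ∈ Icc (-n) n, ∀ x₂ y₂, |x₂ - x₁| < δ → |y₂ - y₁| < δ →
      rectDefect p q x₁ x₂ y₁ y₂ = 0 := by
    intro x₁ hx₁ y₁ hy₁ x₂ y₂ hx hy
    obtain ⟨z, hz⟩ := hcov (x₁, y₁) ⟨hx₁, hy₁⟩
    refine rectDefect_eq_zero_of_primitive hp hq (s := s z) (U := Metric.ball (x₁, y₁) δ)
      (fun w hw => ?_) ?_
    · have : w ∈ {w | HasFDerivAt (s z) (covec (p w) (q w)) w} := interior_subset (hz hw)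
      exact this
    rw [← ball_prod_same]
    refine prod_mono ?_ ?_
    · refine OrdConnected.uIcc_subset (by rw [Real.ball_eq_Ioo]; infer_instance)
        (Metric.mem_ball_self hδ) ?_
      rwa [Metric.mem_ball, Real.dist_eq]
    · refine OrdConnected.uIcc_subset (by rw [Real.ball_eq_Ioo]; infer_instance)
        (Metric.mem_ball_self hδ) ?_
      rwa [Metric.mem_ball, Real.dist_eq]
  have step : ∀ f : ℝ → ℝ, f (-n) = 0 →
      (∀ t ∈ Icc (-n) n, ∀ t', |t' - t| < δ → f t' = f t) → ∀ t ∈ Icc (-n) n, f t = 0 := by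
    intro f f0 hf t ht
    rw [← f0]
    refine constant_of_has_deriv_right_zero (a := -n) (b := n) (fun t ht => ?_)
      (fun t ht => ?_) t ht
    · refine ContinuousAt.continuousWithinAt ?_
      refine (continuousAt_const (y := f t)).congr ?_
      filter_upwards [Metric.ball_mem_nhds t hδ] with t' ht'
      exact (hf t ht t' (by rwa [Metric.mem_ball, Real.dist_eq] at ht')).symm
    · refine HasDerivAt.hasDerivWithinAt ?_
      refine (hasDerivAt_const t (f t)).congr_of_eventuallyEq ?_
      filter_upwards [Metric.ball_mem_nhds t hδ] with t' ht'
      exact hf t ⟨ht.1, ht.2.le⟩ t' (by rwa [Metric.mem_ball, Real.dist_eq] at ht')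
  have strip : ∀ x₁ ∈ Icc (-n) n, ∀ x₂, |x₂ - x₁| < δ → ∀ y ∈ Icc (-n) n,
      rectDefect p q x₁ x₂ (-n) y = 0 := by
    intro x₁ hx₁ x₂ hx
    refine step _ (by simp [rectDefect]) fun t ht t' htt => ?_
    rw [← rectDefect_add_snd hq x₁ x₂ (-n) t t', small x₁ hx₁ t ht x₂ t' hx htt, add_zero]
  have corner : ∀ y ∈ Icc (-n) n, ∀ x ∈ Icc (-n) n, rectDefect p q (-n) x (-n) y = 0 := by
    intro y hy
    refine step _ (by simp [rectDefect]) fun t ht t' htt => ?_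
    rw [← rectDefect_add_fst hp (-n) t t', strip t ht t' htt y hy, add_zero]
  have h0 : (0 : ℝ) ∈ Icc (-n) n := ⟨by linarith, hn0⟩
  have a1 := rectDefect_add_fst (q := q) hp (-n) 0 x (-n) y
  have a2 := rectDefect_add_fst (q := q) hp (-n) 0 x (-n) 0
  have a3 := rectDefect_add_snd (p := p) hq 0 x (-n) 0 y
  rw [corner y hyn 0 h0, corner y hyn x hxn] at a1
  rw [corner 0 h0 0 h0, corner 0 h0 x hxn] at a2
  linarith

end Primitive

section Vectors

/-- The dot product on `ℝ³` as a continuous bilinear map. -/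
def dotL : (Fin 3 → ℝ) →L[ℝ] (Fin 3 → ℝ) →L[ℝ] ℝ :=
  LinearMap.toContinuousBilinearMap (dotProductBilin ℝ ℝ)

/-- The cross product on `ℝ³` as a continuous bilinear map. -/
def crossL : (Fin 3 → ℝ) →L[ℝ] (Fin 3 → ℝ) →L[ℝ] (Fin 3 → ℝ) :=
  LinearMap.toContinuousBilinearMap crossProduct

theorem dotL_apply (a b : Fin 3 → ℝ) : dotL a b = a 0 * b 0 + a 1 * b 1 + a 2 * b 2 := by
  change a ⬝ᵥ b = _
  simp [dotProduct, Fin.sum_univ_three]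

theorem crossL_apply (a b : Fin 3 → ℝ) : crossL a b =
    ![a 1 * b 2 - a 2 * b 1, a 2 * b 0 - a 0 * b 2, a 0 * b 1 - a 1 * b 0] :=
  cross_apply a b

theorem dotL_comm (a b : Fin 3 → ℝ) : dotL a b = dotL b a := by
  simp only [dotL_apply]; ring

theorem crossL_anticomm (a b : Fin 3 → ℝ) : crossL a b = -crossL b a := by
  ext i; fin_cases i <;> simp [crossL_apply] <;> ring

theorem dotL_crossL_self_left (a b : Fin 3 → ℝ) : dotL a (crossL a b) = 0 := by
  simp [dotL_apply, crossL_apply]; ring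

theorem dotL_crossL_self_right (a b : Fin 3 → ℝ) : dotL b (crossL a b) = 0 := by
  simp [dotL_apply, crossL_apply]; ring

theorem dotL_self_nonneg (a : Fin 3 → ℝ) : 0 ≤ dotL a a := by
  rw [dotL_apply]; nlinarith [sq_nonneg (a 0), sq_nonneg (a 1), sq_nonneg (a 2)]

theorem dotL_self_pos {a : Fin 3 → ℝ} (h : a ≠ 0) : 0 < dotL a a := by
  refine lt_of_le_of_ne (dotL_self_nonneg a) fun h0 => h ?_
  rw [dotL_apply] at h0
  ext i
  fin_cases i <;> simp <;> nlinarith [sq_nonneg (a 0), sq_nonneg (a 1), sq_nonneg (a 2)]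

theorem dotL_sq_le (a b : Fin 3 → ℝ) : dotL a b ^ 2 ≤ dotL a a * dotL b b := by
  simp only [dotL_apply]
  nlinarith [sq_nonneg (a 0 * b 1 - a 1 * b 0), sq_nonneg (a 0 * b 2 - a 2 * b 0),
    sq_nonneg (a 1 * b 2 - a 2 * b 1)]

theorem HasDerivAt.dotL {f g : ℝ → Fin 3 → ℝ} {f' g' : Fin 3 → ℝ} {x : ℝ}
    (hf : HasDerivAt f f' x) (hg : HasDerivAt g g' x) :
    HasDerivAt (fun x => _root_.dotL (f x) (g x)) (_root_.dotL (f x) g' + _root_.dotL f' (g x)) x :=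
  _root_.dotL.hasDerivAt_of_bilinear (fun _ => hf) (fun _ => hg)

end Vectors

section Transport

theorem integral_add_mul_unit {F : Type*} [NormedAddCommGroup F] [NormedSpace ℝ F]
    (f : ℝ → F) (x : ℝ) {ε : ℝ} (hε : ε ≠ 0) :
    ∫ σ in (0 : ℝ)..1, f (x + ε * σ) = ε⁻¹ • ∫ t in x..(x + ε), f t := by
  rw [integral_comp_add_mul f hε x]
  simp

theorem continuous_average {F : Type*} [NormedAddCommGroup F] [NormedSpace ℝ F]
    {f : ℝ × ℝ → F} (hf : Continuous f) :
    Continuous fun a : ℝ × ℝ × ℝ => ∫ σ in (0 : ℝ)..1, f (a.2.1 + a.1 * σ, a.2.2) := by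
  refine continuous_parametric_intervalIntegral_of_continuous'
    (f := fun (a : ℝ × ℝ × ℝ) σ => f (a.2.1 + a.1 * σ, a.2.2)) ?_ _ _
  simp only [Function.uncurry_def]; fun_prop

/-- The divergence theorem for the vector field `(-q, p)` on a rectangle. -/
theorem rectDefect_eq_integral {p q A B : ℝ × ℝ → ℝ} (hp : Continuous p) (hq : Continuous q)
    (hA : Continuous A) (hB : Continuous B) {x₁ x₂ y₁ y₂ : ℝ}
    (hpA : ∀ x ∈ uIcc x₁ x₂, ∀ y ∈ uIcc y₁ y₂, HasDerivAt (fun y => p (x, y)) (A (x, y)) y)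
    (hqB : ∀ x ∈ uIcc x₁ x₂, ∀ y ∈ uIcc y₁ y₂, HasDerivAt (fun x => q (x, y)) (B (x, y)) x) :
    rectDefect p q x₁ x₂ y₁ y₂ = ∫ x in x₁..x₂, ∫ y in y₁..y₂, (A (x, y) - B (x, y)) := by
  have e1 : (∫ x in x₁..x₂, p (x, y₂)) - ∫ x in x₁..x₂, p (x, y₁) =
      ∫ x in x₁..x₂, ∫ y in y₁..y₂, A (x, y) := by
    rw [← integral_sub (Continuous.intervalIntegrable (by fun_prop) _ _)
      (Continuous.intervalIntegrable (by fun_prop) _ _)]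
    refine integral_congr fun x hx => ?_
    exact (integral_eq_sub_of_hasDerivAt (hpA x hx)
      (Continuous.intervalIntegrable (by fun_prop) _ _)).symm
  have e2 : (∫ y in y₁..y₂, q (x₂, y)) - ∫ y in y₁..y₂, q (x₁, y) =
      ∫ x in x₁..x₂, ∫ y in y₁..y₂, B (x, y) := by
    rw [integral_swap_of_continuous (f := fun x y => B (x, y)) (by simpa [Function.uncurry_def]),
      ← integral_sub (Continuous.intervalIntegrable (by fun_prop) _ _)
      (Continuous.intervalIntegrable (by fun_prop) _ _)]
    refine integral_congr fun y hy => ?_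
    exact (integral_eq_sub_of_hasDerivAt (fun x hx => hqB x hx y hy)
      (Continuous.intervalIntegrable (by fun_prop) _ _)).symm
  rw [rectDefect, e1, e2, ← integral_sub (Continuous.intervalIntegrable (by fun_prop) _ _)
      (Continuous.intervalIntegrable (by fun_prop) _ _)]
  congr 1
  funext x
  exact (integral_sub (Continuous.intervalIntegrable (by fun_prop) _ _)
      (Continuous.intervalIntegrable (by fun_prop) _ _)).symm

/-- A regularized length of a vector. -/
def lengthAbove (c : ℝ) (v : Fin 3 → ℝ) : ℝ := √(max (dotL v v) c)

theorem continuous_lengthAbove (c : ℝ) : Continuous (lengthAbove c) := by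
  unfold lengthAbove
  fun_prop

theorem lengthAbove_pos {c : ℝ} (hc : 0 < c) (v : Fin 3 → ℝ) : 0 < lengthAbove c v :=
  Real.sqrt_pos.2 (lt_max_of_lt_right hc)

theorem lengthAbove_sq {c : ℝ} {v : Fin 3 → ℝ} (h : c ≤ dotL v v) :
    lengthAbove c v ^ 2 = dotL v v := by
  rw [lengthAbove, max_eq_left h, Real.sq_sqrt (dotL_self_nonneg v)]

theorem hasDerivAt_lengthAbove {c : ℝ} {v : ℝ → Fin 3 → ℝ} {v' : Fin 3 → ℝ} {x : ℝ}
    (hv : HasDerivAt v v' x) (hc : 0 < c) (h : ∀ᶠ y in 𝓝 x, c ≤ dotL (v y) (v y)) :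
    HasDerivAt (fun y => lengthAbove c (v y)) (dotL (v x) v' / lengthAbove c (v x)) x := by
  have hx := h.self_of_nhds
  have h1 : (fun y => lengthAbove c (v y)) =ᶠ[𝓝 x] fun y => √(dotL (v y) (v y)) := by
    filter_upwards [h] with y hy
    rw [lengthAbove, max_eq_left hy]
  have h2 := (hv.dotL hv).sqrt (by linarith)
  refine (h2.congr_of_eventuallyEq h1).congr_deriv ?_
  rw [lengthAbove, max_eq_left hx, dotL_comm v' (v x), ← two_mul,
    mul_div_mul_left _ _ two_ne_zero]

theorem continuous_rectIntegral {f : ℝ × ℝ × ℝ → ℝ} (hf : Continuous f) (x₁ x₂ y₁ y₂ : ℝ) :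
    Continuous fun ε => ∫ x in x₁..x₂, ∫ y in y₁..y₂, f (ε, x, y) := by
  refine continuous_parametric_intervalIntegral_of_continuous'
    (f := fun ε x => ∫ y in y₁..y₂, f (ε, x, y)) ?_ _ _
  simp only [Function.uncurry_def]
  refine continuous_parametric_intervalIntegral_of_continuous'
    (f := fun (w : ℝ × ℝ) y => f (w.1, w.2, y)) ?_ _ _
  simp only [Function.uncurry_def]; fun_prop

theorem continuous_rectDefect {p q : ℝ × ℝ × ℝ → ℝ} (hp : Continuous p) (hq : Continuous q)
    (x₁ x₂ y₁ y₂ : ℝ) :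
    Continuous fun ε => rectDefect (fun z => p (ε, z)) (fun z => q (ε, z)) x₁ x₂ y₁ y₂ := by
  have aux : ∀ {g : ℝ × ℝ → ℝ}, Continuous g → ∀ a b : ℝ,
      Continuous fun ε => ∫ x in a..b, g (ε, x) := fun hg a b =>
    continuous_parametric_intervalIntegral_of_continuous' (by simpa [Function.uncurry_def]) _ _
  unfold rectDefect
  refine ((aux (g := fun w => p (w.1, w.2, y₂)) (by fun_prop) _ _).sub
    (aux (g := fun w => p (w.1, w.2, y₁)) (by fun_prop) _ _)).sub
    ((aux (g := fun w => q (w.1, x₂, w.2)) (by fun_prop) _ _).sub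
    (aux (g := fun w => q (w.1, x₁, w.2)) (by fun_prop) _ _))

variable {V W Z : ℝ × ℝ → Fin 3 → ℝ} {r : ℝ × ℝ → ℝ} {e : Fin 3 → ℝ} {a₁ a₂ b₁ b₂ : ℝ}

theorem le_dotL_self_of_dotL_eq_one {c : ℝ} (hc : c * dotL e e ≤ 1) {v : Fin 3 → ℝ}
    (hv : dotL v e = 1) : c ≤ dotL v v := by
  have h := dotL_sq_le v e
  rw [hv] at h
  have h0 := dotL_self_nonneg e
  have h1 : 0 < dotL e e := by
    refine lt_of_le_of_ne h0 fun h' => ?_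
    rw [← h'] at h
    norm_num at h
  nlinarith

/-- If a continuous vector field `V` satisfies, in integrated form, `V_y + (r V)_x = Z` with `Z`
orthogonal to `V` and `V ⬝ e` constant, then its length `f` satisfies, in integrated form,
`f_y + (r f)_x = 0`. -/
theorem rectDefect_length_eq_zero (hV : Continuous V) (hZ : Continuous Z) (hWc : Continuous W)
    (hr : ContDiff ℝ 1 r)
    (hG : ∀ x₁ x₂ y, HasDerivAt (fun y => ∫ x in x₁..x₂, V (x, y))
      ((∫ x in x₁..x₂, Z (x, y)) + (W (x₂, y) - W (x₁, y))) y)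
    (hW : ∀ z ∈ Ioo a₁ a₂ ×ˢ Ioo b₁ b₂, W z = -(r z • V z))
    (hVe : ∀ z ∈ Ioo a₁ a₂ ×ˢ Ioo b₁ b₂, dotL (V z) e = 1)
    (hZV : ∀ z ∈ Ioo a₁ a₂ ×ˢ Ioo b₁ b₂, dotL (V z) (Z z) = 0)
    {c : ℝ} (hc : 0 < c) (hce : c * dotL e e ≤ 1) {x₁ x₂ y₁ y₂ : ℝ}
    (hx₁ : x₁ ∈ Ioo a₁ a₂) (hx₂ : x₂ ∈ Ioo a₁ a₂) (hy₁ : y₁ ∈ Ioo b₁ b₂) (hy₂ : y₂ ∈ Ioo b₁ b₂) :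
    rectDefect (fun z => lengthAbove c (V z)) (fun z => -(lengthAbove c (V z) * r z))
      x₁ x₂ y₁ y₂ = 0 := by
  have cr := hr.continuous
  have cr1 := hr.continuous_d1
  let T : ℝ × ℝ × ℝ → Fin 3 → ℝ := fun a => ∫ σ in (0 : ℝ)..1, V (a.2.1 + a.1 * σ, a.2.2)
  let S : ℝ × ℝ × ℝ → Fin 3 → ℝ := fun a => ∫ σ in (0 : ℝ)..1, Z (a.2.1 + a.1 * σ, a.2.2)
  let R : ℝ × ℝ × ℝ → ℝ := fun a => ∫ σ in (0 : ℝ)..1, d1 r (a.2.1 + a.1 * σ, a.2.2)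
  have cT : Continuous T := continuous_average hV
  have cS : Continuous S := continuous_average hZ
  have cR : Continuous R := continuous_average cr1
  let g : ℝ × ℝ × ℝ → ℝ := fun a => lengthAbove c (T a)
  have cg : Continuous g := (continuous_lengthAbove c).comp cT
  have gpos : ∀ a, 0 < g a := fun a => lengthAbove_pos hc _
  let D : ℝ × ℝ × ℝ → ℝ := fun a =>
    dotL (T a) (S a - R a • V (a.2.1 + a.1, a.2.2)) / g a + g a * d1 r a.2
  have cD : Continuous D :=
    (Continuous.div (by fun_prop) cg fun a => (gpos a).ne').add (by fun_prop)
  have hsubx : uIcc x₁ x₂ ⊆ Ioo a₁ a₂ := ordConnected_Ioo.uIcc_subset hx₁ hx₂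
  have hsuby : uIcc y₁ y₂ ⊆ Ioo b₁ b₂ := ordConnected_Ioo.uIcc_subset hy₁ hy₂
  have hTe : ∀ ε, 0 < ε → ∀ x y, x ∈ Ioo a₁ a₂ → x + ε ∈ Ioo a₁ a₂ → y ∈ Ioo b₁ b₂ →
      c ≤ dotL (T (ε, x, y)) (T (ε, x, y)) := by
    intro ε hε x y hx hxε hy
    refine le_dotL_self_of_dotL_eq_one hce ?_
    have h1 : dotL (T (ε, x, y)) e = ∫ σ in (0 : ℝ)..1, dotL (V (x + ε * σ, y)) e :=
      ((dotL.flip e).intervalIntegral_comp_comm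
        (Continuous.intervalIntegrable (by fun_prop) _ _)).symm
    rw [h1, integral_congr (g := fun _ => (1 : ℝ)) fun σ hσ => ?_]
    · simp
    · rw [uIcc_of_le zero_le_one] at hσ
      refine hVe (x + ε * σ, y) ⟨⟨?_, ?_⟩, hy⟩
      · have := mul_nonneg hε.le hσ.1
        linarith [hx.1]
      · have := mul_le_mul_of_nonneg_left hσ.2 hε.le
        linarith [hxε.2]
  have hpos : ∀ ε, 0 < ε → (∀ x ∈ uIcc x₁ x₂, x + ε < a₂) →
      rectDefect (fun z => g (ε, z)) (fun z => -(g (ε, z) * r z)) x₁ x₂ y₁ y₂ =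
        ∫ x in x₁..x₂, ∫ y in y₁..y₂, D (ε, x, y) := by
    intro ε hε hεa
    let Ty : ℝ × ℝ → Fin 3 → ℝ := fun z => S (ε, z) + ε⁻¹ • (W (z.1 + ε, z.2) - W z)
    let Tx : ℝ × ℝ → Fin 3 → ℝ := fun z => ε⁻¹ • (V (z.1 + ε, z.2) - V z)
    have hTy : ∀ x y, HasDerivAt (fun y => T (ε, x, y)) (Ty (x, y)) y := by
      intro x y
      have e1 : (fun y => T (ε, x, y)) = fun y => ε⁻¹ • ∫ t in x..(x + ε), V (t, y) := by
        funext y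
        exact integral_add_mul_unit (fun t => V (t, y)) x hε.ne'
      have e2 : Ty (x, y) = ε⁻¹ • ((∫ t in x..(x + ε), Z (t, y)) + (W (x + ε, y) - W (x, y))) := by
        simp only [Ty, S]
        rw [integral_add_mul_unit (fun t => Z (t, y)) x hε.ne', smul_add]
      rw [e1, e2]
      exact (hG x (x + ε) y).const_smul ε⁻¹
    have hTx : ∀ x y, HasDerivAt (fun x => T (ε, x, y)) (Tx (x, y)) x := by
      intro x y
      have e1 : (fun x => T (ε, x, y)) =
          fun x => ε⁻¹ • ((∫ t in (0 : ℝ)..(x + ε), V (t, y)) - ∫ t in (0 : ℝ)..x, V (t, y)) := by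
        funext x
        rw [integral_interval_sub_left (Continuous.intervalIntegrable (by fun_prop) _ _)
          (Continuous.intervalIntegrable (by fun_prop) _ _)]
        exact integral_add_mul_unit (fun t => V (t, y)) x hε.ne'
      rw [e1]
      have hF : ∀ x, HasDerivAt (fun x => ∫ t in (0 : ℝ)..x, V (t, y)) (V (x, y)) x := fun x =>
        (Continuous.integral_hasStrictDerivAt (f := fun t => V (t, y)) (by fun_prop)
          0 x).hasDerivAt
      exact (((hF (x + ε)).comp_add_const x ε).sub (hF x)).const_smul ε⁻¹
    have cTy : Continuous Ty := by fun_prop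
    have cTx : Continuous Tx := by fun_prop
    let A : ℝ × ℝ → ℝ := fun z => dotL (T (ε, z)) (Ty z) / g (ε, z)
    let B : ℝ × ℝ → ℝ := fun z =>
      -(dotL (T (ε, z)) (Tx z) / g (ε, z) * r z + g (ε, z) * d1 r z)
    have cA : Continuous A := Continuous.div (by fun_prop) (by fun_prop) fun a => (gpos _).ne'
    have cB : Continuous B := by
      refine ((Continuous.mul (Continuous.div ?_ ?_ fun a => (gpos _).ne') ?_).add ?_).neg <;>
        fun_prop
    rw [rectDefect_eq_integral (A := A) (B := B) (by fun_prop) (by fun_prop) cA cB]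
    · refine integral_congr fun x hx => integral_congr fun y hy => ?_
      have hx' := hsubx hx
      have hxε : x + ε ∈ Ioo a₁ a₂ := ⟨by linarith [hx'.1], hεa x hx⟩
      have hy' := hsuby hy
      have hR : R (ε, x, y) = ε⁻¹ * (r (x + ε, y) - r (x, y)) := by
        have := integral_add_mul_unit (fun t => d1 r (t, y)) x hε.ne'
        rw [integral_eq_sub_of_hasDerivAt (fun t _ => hr.hasDerivAt_d1 t y)
          (Continuous.intervalIntegrable (by fun_prop) _ _)] at this
        simpa [R] using this
      have hsum : Ty (x, y) + r (x, y) • Tx (x, y) =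
          S (ε, x, y) - R (ε, x, y) • V (x + ε, y) := by
        simp only [Ty, Tx, hR, hW (x, y) ⟨hx', hy'⟩, hW (x + ε, y) ⟨hxε, hy'⟩]
        module
      have hd : dotL (T (ε, x, y)) (S (ε, x, y) - R (ε, x, y) • V (x + ε, y)) =
          dotL (T (ε, x, y)) (Ty (x, y)) + r (x, y) * dotL (T (ε, x, y)) (Tx (x, y)) := by
        rw [← hsum, (dotL (T (ε, x, y))).map_add (Ty (x, y)), map_smul, smul_eq_mul]
      change A (x, y) - B (x, y) = _
      simp only [D, hd]
      simp only [A, B]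
      ring
    · intro x hx y hy
      refine hasDerivAt_lengthAbove (v := fun y => T (ε, x, y)) (hTy x y) hc ?_
      filter_upwards [isOpen_Ioo.mem_nhds (hsuby hy)] with y' hy'
      exact hTe ε hε x y' (hsubx hx) ⟨by linarith [(hsubx hx).1], hεa x hx⟩ hy'
    · intro x hx y hy
      refine (HasDerivAt.mul (hasDerivAt_lengthAbove (v := fun x => T (ε, x, y)) (hTx x y) hc ?_)
        (hr.hasDerivAt_d1 x y)).neg
      filter_upwards [isOpen_Ioo.mem_nhds (hsubx hx), (isOpen_Iio (a := a₂ - ε)).mem_nhds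
        (show x < a₂ - ε by linarith [hεa x hx])] with x' hx' hx''
      have : x' < a₂ - ε := hx''
      exact hTe ε hε x' y hx' ⟨by linarith [hx'.1], by linarith⟩ (hsuby hy)
  have hlim : rectDefect (fun z => g (0, z)) (fun z => -(g (0, z) * r z)) x₁ x₂ y₁ y₂ =
      ∫ x in x₁..x₂, ∫ y in y₁..y₂, D (0, x, y) := by
    have c1 := continuous_rectDefect (p := g) (q := fun a => -(g a * r a.2)) cg (by fun_prop)
      x₁ x₂ y₁ y₂
    have c2 := continuous_rectIntegral cD x₁ x₂ y₁ y₂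
    refine tendsto_nhds_unique_of_eventuallyEq (l := 𝓝[>] 0)
      (c1.continuousAt.tendsto.mono_left nhdsWithin_le_nhds)
      (c2.continuousAt.tendsto.mono_left nhdsWithin_le_nhds) ?_
    have hmax : max x₁ x₂ < a₂ := max_lt hx₁.2 hx₂.2
    filter_upwards [Ioo_mem_nhdsGT (sub_pos.2 hmax)] with ε hε
    refine hpos ε hε.1 fun x hx => ?_
    have h1 : x ≤ max x₁ x₂ := hx.2
    linarith [hε.2]
  have hT0 : ∀ z, T (0, z) = V z := fun z => by simp [T]
  simp only [g, hT0] at hlim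
  rw [hlim]
  refine (integral_congr (g := fun _ => (0 : ℝ)) fun x hx => ?_).trans (by simp)
  refine (integral_congr (g := fun _ => (0 : ℝ)) fun y hy => ?_).trans (by simp)
  have hz : (x, y) ∈ Ioo a₁ a₂ ×ˢ Ioo b₁ b₂ := ⟨hsubx hx, hsuby hy⟩
  have hsq := lengthAbove_sq (le_dotL_self_of_dotL_eq_one hce (hVe _ hz))
  have hp := lengthAbove_pos hc (V (x, y))
  simp only [D, g, hT0, S, R, zero_mul, add_zero, intervalIntegral.integral_const, sub_zero, one_smul, map_sub,
    hZV _ hz, map_smul, smul_eq_mul, ← hsq, zero_sub]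
  field_simp
  ring

end Transport

section LocalInverse

theorem exists_contDiff_eventuallyEq {F : Type*} [NormedAddCommGroup F] [NormedSpace ℝ F]
    {f : ℝ × ℝ → F} {x : ℝ × ℝ} (h : ContDiffAt ℝ 1 f x) :
    ∃ g, ContDiff ℝ 1 g ∧ g =ᶠ[𝓝 x] f := by
  obtain ⟨ε, hε, hball⟩ := Metric.eventually_nhds_iff_ball.1 (h.eventually (by simp))
  let χ : ContDiffBump x := ⟨ε / 4, ε / 2, by linarith, by linarith⟩
  refine ⟨fun y => χ y • f y, contDiff_iff_contDiffAt.2 fun y => ?_, ?_⟩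
  · by_cases hy : y ∈ Metric.ball x ε
    · exact χ.contDiff.contDiffAt.smul (hball y hy)
    · refine (contDiffAt_const (c := 0)).congr_of_eventuallyEq ?_
      have hy' : y ∈ (Metric.closedBall x (ε / 2))ᶜ := by
        rw [Metric.mem_ball, not_lt] at hy
        rw [mem_compl_iff, Metric.mem_closedBall, not_le]
        linarith
      filter_upwards [Metric.isClosed_closedBall.isOpen_compl.mem_nhds hy'] with w hw
      rw [mem_compl_iff, Metric.mem_closedBall, not_le] at hw
      rw [χ.zero_of_le_dist hw.le, zero_smul]
  · filter_upwards [χ.eventuallyEq_one] with y hy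
    rw [hy]
    simp

/-- The Jacobian determinant of a map of the plane. -/
def jacDet (f : ℝ × ℝ → ℝ × ℝ) (z : ℝ × ℝ) : ℝ :=
  (d1 f z).1 * (d2 f z).2 - (d1 f z).2 * (d2 f z).1

theorem exists_equiv_of_jacDet_ne_zero {f : ℝ × ℝ → ℝ × ℝ} {z : ℝ × ℝ} (h : jacDet f z ≠ 0) :
    ∃ e : (ℝ × ℝ) ≃L[ℝ] (ℝ × ℝ), (e : ℝ × ℝ →L[ℝ] ℝ × ℝ) = fderiv ℝ f z := by
  let L' : ℝ × ℝ →L[ℝ] ℝ × ℝ := (jacDet f z)⁻¹ •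
    covec ((d2 f z).2, -(d1 f z).2) (-(d2 f z).1, (d1 f z).1)
  have hL : ∀ w, fderiv ℝ f z w = w.1 • d1 f z + w.2 • d2 f z := clm_prod_apply _
  refine ⟨ContinuousLinearEquiv.equivOfInverse (fderiv ℝ f z) L' (fun w => ?_) fun w => ?_, rfl⟩
  · rw [hL]
    ext <;> simp [L'] <;> field_simp <;> simp only [jacDet] <;> ring
  · rw [hL]
    ext <;> simp [L'] <;> field_simp <;> simp only [jacDet] <;> ring

theorem exists_openPartialHomeomorph {f : ℝ × ℝ → ℝ × ℝ} (hf : ContDiff ℝ 1 f) {z : ℝ × ℝ}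
    (h : jacDet f z ≠ 0) : ∃ Φ : OpenPartialHomeomorph (ℝ × ℝ) (ℝ × ℝ),
      z ∈ Φ.source ∧ (Φ : ℝ × ℝ → ℝ × ℝ) = f ∧ ContDiffAt ℝ 1 Φ.symm (f z) := by
  obtain ⟨e, he⟩ := exists_equiv_of_jacDet_ne_zero h
  have hd : HasFDerivAt f (e : ℝ × ℝ →L[ℝ] ℝ × ℝ) z := by rw [he]; exact hf.hasFDerivAt_one z
  exact ⟨hf.contDiffAt.toOpenPartialHomeomorph f hd one_ne_zero,
    hf.contDiffAt.mem_toOpenPartialHomeomorph_source hd one_ne_zero, rfl,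
    hf.contDiffAt.to_localInverse hd one_ne_zero⟩

/-- The local inverse of a map of the plane with nonvanishing Jacobian, extended to the plane. -/
theorem exists_contDiff_local_inverse {f : ℝ × ℝ → ℝ × ℝ} (hf : ContDiff ℝ 1 f) {z : ℝ × ℝ}
    (h : jacDet f z ≠ 0) : ∃ g : ℝ × ℝ → ℝ × ℝ, ContDiff ℝ 1 g ∧ g (f z) = z ∧
      (∀ᶠ y in 𝓝 (f z), f (g y) = y) ∧ ∀ᶠ w in 𝓝 z, g (f w) = w := by
  obtain ⟨Φ, hz, rfl, hΦ⟩ := exists_openPartialHomeomorph hf h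
  obtain ⟨g, hg, hgΦ⟩ := exists_contDiff_eventuallyEq hΦ
  refine ⟨g, hg, ?_, ?_, ?_⟩
  · rw [hgΦ.eq_of_nhds, Φ.left_inv hz]
  · filter_upwards [hgΦ, Φ.open_target.mem_nhds (Φ.map_source hz)] with y hy hyt
    rw [hy, Φ.right_inv hyt]
  · filter_upwards [hf.continuous.continuousAt.eventually hgΦ, Φ.open_source.mem_nhds hz]
      with w hw hws
    rw [hw, Φ.left_inv hws]

end LocalInverse

section Vectors

theorem dotL_crossL_crossL (a b c d : Fin 3 → ℝ) :
    dotL (crossL a b) (crossL c d) = dotL a c * dotL b d - dotL a d * dotL b c := by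
  simp [dotL_apply, crossL_apply]; ring

theorem dotL_crossL_rotate (a b c : Fin 3 → ℝ) : dotL (crossL a b) c = dotL a (crossL b c) := by
  simp [dotL_apply, crossL_apply]; ring

/-- Three vectors orthogonal to a unit vector have vanishing triple product. -/
theorem triple_eq_zero_of_orthogonal {a b c n : Fin 3 → ℝ} (hn : dotL n n = 1)
    (ha : dotL a n = 0) (hb : dotL b n = 0) (hc : dotL c n = 0) : dotL a (crossL b c) = 0 := by
  have h : dotL a (crossL b c) * dotL n n = dotL a n * dotL (crossL b c) n +
      dotL b n * dotL (crossL c a) n + dotL c n * dotL (crossL a b) n := by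
    simp [dotL_apply, crossL_apply]; ring
  rw [hn, ha, hb, hc] at h
  linarith

theorem one_le_crossL_sq {c x n : Fin 3 → ℝ} (hx : dotL x x = 1) (hn : dotL n n = 1)
    (hxn : dotL x n = 0) (hcn : dotL c n = 1) : 1 ≤ dotL (crossL c x) (crossL c x) := by
  rw [dotL_crossL_crossL, hx, dotL_comm x c]
  have h := dotL_sq_le (c - dotL c x • x) n
  simp only [map_sub, map_smul, _root_.sub_apply, _root_.smul_apply, smul_eq_mul, hxn, hcn, hn,
    hx, dotL_comm x c] at h
  linarith

theorem d1_orthogonal_of_unit {N : ℝ × ℝ → Fin 3 → ℝ} (hN : ContDiff ℝ 1 N)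
    (hNN : ∀ z, dotL (N z) (N z) = 1) (z : ℝ × ℝ) : dotL (d1 N z) (N z) = 0 := by
  have h := (hN.hasDerivAt_d1 z.1 z.2).dotL (hN.hasDerivAt_d1 z.1 z.2)
  simp only [hNN] at h
  have := h.unique (hasDerivAt_const _ _)
  rw [dotL_comm] at this
  linarith

theorem d2_orthogonal_of_unit {N : ℝ × ℝ → Fin 3 → ℝ} (hN : ContDiff ℝ 1 N)
    (hNN : ∀ z, dotL (N z) (N z) = 1) (z : ℝ × ℝ) : dotL (d2 N z) (N z) = 0 := by
  have h := (hN.hasDerivAt_d2 z.1 z.2).dotL (hN.hasDerivAt_d2 z.1 z.2)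
  simp only [hNN] at h
  have := h.unique (hasDerivAt_const _ _)
  rw [dotL_comm] at this
  linarith

/-- Green's formula for the vector-valued one-form `(du + N × dN) / 2`. -/
theorem hasDerivAt_integral_asymptotic {u N : ℝ × ℝ → Fin 3 → ℝ} (hu : ContDiff ℝ 1 u)
    (hN : ContDiff ℝ 1 N) (x₁ x₂ y : ℝ) :
    HasDerivAt (fun y => ∫ x in x₁..x₂,
        (1 / 2 : ℝ) • (d1 u (x, y) + crossL (N (x, y)) (d1 N (x, y))))
      ((∫ x in x₁..x₂, -crossL (d1 N (x, y)) (d2 N (x, y))) +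
        ((1 / 2 : ℝ) • (d2 u (x₂, y) + crossL (N (x₂, y)) (d2 N (x₂, y))) -
          (1 / 2 : ℝ) • (d2 u (x₁, y) + crossL (N (x₁, y)) (d2 N (x₁, y))))) y := by
  have cu := hu.continuous_d1
  have cN := hN.continuous
  have cN1 := hN.continuous_d1
  have cN2 := hN.continuous_d2
  have e : (fun y => ∫ x in x₁..x₂,
      (1 / 2 : ℝ) • (d1 u (x, y) + crossL (N (x, y)) (d1 N (x, y)))) =
      fun y => (1 / 2 : ℝ) • ((u (x₂, y) - u (x₁, y)) +
        ∫ x in x₁..x₂, crossL (N (x, y)) (d1 N (x, y))) := by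
    funext y
    rw [intervalIntegral.integral_smul, integral_add (Continuous.intervalIntegrable (by fun_prop) _ _)
      (Continuous.intervalIntegrable (by fun_prop) _ _),
      integral_eq_sub_of_hasDerivAt (fun x _ => hu.hasDerivAt_d1 x y)
      (Continuous.intervalIntegrable (by fun_prop) _ _)]
  rw [e]
  refine ((((hu.hasDerivAt_d2 x₂ y).sub (hu.hasDerivAt_d2 x₁ y)).add
    (hasDerivAt_integral_bilin_d1 crossL hN hN x₁ x₂ y)).const_smul (1 / 2 : ℝ)).congr_deriv ?_
  have e2 : ∫ x in x₁..x₂, (crossL (d2 N (x, y)) (d1 N (x, y)) -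
      crossL (d1 N (x, y)) (d2 N (x, y))) =
      (2 : ℝ) • ∫ x in x₁..x₂, -crossL (d1 N (x, y)) (d2 N (x, y)) := by
    rw [← intervalIntegral.integral_smul]
    congr 1
    funext x
    rw [crossL_anticomm (d2 N (x, y))]
    module
  rw [e2]
  module

end Vectors

section LocalClosedness

theorem fderiv_comp_plane {F : Type*} [NormedAddCommGroup F] [NormedSpace ℝ F]
    {f : ℝ × ℝ → F} {Γ : ℝ × ℝ → ℝ × ℝ} (hf : ContDiff ℝ 1 f) (hΓ : ContDiff ℝ 1 Γ)
    (y v : ℝ × ℝ) : fderiv ℝ (fun y => f (Γ y)) y v =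
      (fderiv ℝ Γ y v).1 • d1 f (Γ y) + (fderiv ℝ Γ y v).2 • d2 f (Γ y) := by
  have h : HasFDerivAt (fun y => f (Γ y)) _ y :=
    (hf.hasFDerivAt_one (Γ y)).comp y (hΓ.hasFDerivAt_one y)
  rw [h.fderiv, ContinuousLinearMap.comp_apply, clm_prod_apply]
  rfl

theorem asymptotic_comp {u N X : ℝ × ℝ → Fin 3 → ℝ} {p q : ℝ × ℝ → ℝ} {Γ : ℝ × ℝ → ℝ × ℝ}
    (hu : ContDiff ℝ 1 u) (hN : ContDiff ℝ 1 N) (hΓ : ContDiff ℝ 1 Γ)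
    (h1 : ∀ z, d1 u z + crossL (N z) (d1 N z) = (2 * p z) • X z)
    (h2 : ∀ z, d2 u z + crossL (N z) (d2 N z) = (2 * q z) • X z) (y v : ℝ × ℝ) :
    fderiv ℝ (fun y => u (Γ y)) y v + crossL (N (Γ y)) (fderiv ℝ (fun y => N (Γ y)) y v) =
      (2 * ((fderiv ℝ Γ y v).1 * p (Γ y) + (fderiv ℝ Γ y v).2 * q (Γ y))) • X (Γ y) := by
  rw [fderiv_comp_plane hu hΓ, fderiv_comp_plane hN hΓ, map_add, map_smul, map_smul]
  have e1 := h1 (Γ y)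
  have e2 := h2 (Γ y)
  rw [← eq_sub_iff_add_eq] at e1 e2
  rw [e1, e2]
  module

/-- Contact coordinates: the one-form `(du + N × dN) / 2`, in a constant direction, is
`dM - r db`. -/
theorem contact_identity (c₁ c₂ n du dn : Fin 3 → ℝ) :
    dotL (crossL c₁ c₂) (du + crossL n dn) = 2 * ((1 / 2) * (dotL (crossL c₁ c₂) du -
      (dotL c₁ n * dotL c₂ dn + dotL c₁ dn * dotL c₂ n)) + dotL c₁ n * dotL c₂ dn) := by
  rw [map_add, dotL_crossL_crossL]
  ring

theorem exists_contact_vectors {n x w : Fin 3 → ℝ} (hn : dotL n n = 1) (hx : dotL x x = 1)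
    (hxn : dotL x n = 0) (hwn : dotL w n = 0) (hw : w ≠ 0) :
    ∃ c₁ c₂ : Fin 3 → ℝ, 0 < dotL (crossL c₁ c₂) x ∧ 0 < dotL c₂ w := by
  refine ⟨crossL (w + n) x, w + n, ?_, ?_⟩
  · rw [dotL_crossL_rotate]
    have h := one_le_crossL_sq (c := w + n) hx hn hxn
      (by rw [map_add, _root_.add_apply, hwn, hn, zero_add])
    linarith
  · rw [map_add, _root_.add_apply, dotL_comm n, hwn, add_zero]
    exact dotL_self_pos hw

variable {u N X : ℝ × ℝ → Fin 3 → ℝ} {p q : ℝ × ℝ → ℝ}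

theorem asymptotic_ne_zero
    (h1 : ∀ z, d1 u z + crossL (N z) (d1 N z) = (2 * p z) • X z)
    (h2 : ∀ z, d2 u z + crossL (N z) (d2 N z) = (2 * q z) • X z)
    {z : ℝ × ℝ} (hne : q z • d1 u z - p z • d2 u z ≠ 0) :
    p z • d2 N z - q z • d1 N z ≠ 0 := by
  intro h
  refine hne ?_
  have h3 := congrArg (crossL (N z)) h
  have e1 := h1 z
  have e2 := h2 z
  rw [← eq_sub_iff_add_eq] at e1 e2
  rw [map_sub, map_smul, map_smul, map_zero] at h3
  rw [e1, e2, smul_sub, smul_sub, smul_smul, smul_smul, mul_left_comm, mul_comm (p z),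
    ← mul_assoc, sub_sub_sub_cancel_left]
  rw [← sub_eq_zero, ← sub_eq_zero] at h3
  simpa [sub_eq_zero, eq_comm] using h3

/-- The one-form `p dx + q dy` determined by `du + N × dN = 2 X (p dx + q dy)` with `X` a unit
tangent field has local primitives. -/
theorem exists_local_primitive (hu : ContDiff ℝ 1 u) (hN : ContDiff ℝ 1 N) (hX : Continuous X)
    (h1 : ∀ z, d1 u z + crossL (N z) (d1 N z) = (2 * p z) • X z)
    (h2 : ∀ z, d2 u z + crossL (N z) (d2 N z) = (2 * q z) • X z)
    (hXX : ∀ z, dotL (X z) (X z) = 1) (hXN : ∀ z, dotL (X z) (N z) = 0)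
    (hNN : ∀ z, dotL (N z) (N z) = 1)
    (hne : ∀ z, q z • d1 u z - p z • d2 u z ≠ 0) (z₀ : ℝ × ℝ) :
    ∃ s : ℝ × ℝ → ℝ, ∀ᶠ w in 𝓝 z₀, HasFDerivAt s (covec (p w) (q w)) w := by
  obtain ⟨c₁, c₂, he0, hc0⟩ := exists_contact_vectors (hNN z₀) (hXX z₀) (hXN z₀)
    (w := p z₀ • d2 N z₀ - q z₀ • d1 N z₀)
    (by simp [d1_orthogonal_of_unit hN hNN, d2_orthogonal_of_unit hN hNN])
    (asymptotic_ne_zero h1 h2 (hne z₀))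
  set e := crossL c₁ c₂ with he
  let M : ℝ × ℝ → ℝ := fun z => (1 / 2) * (dotL e (u z) - dotL c₁ (N z) * dotL c₂ (N z))
  let b : ℝ × ℝ → ℝ := fun z => dotL c₂ (N z)
  let r : ℝ × ℝ → ℝ := fun z => -dotL c₁ (N z)
  have hM : ContDiff ℝ 1 M := by fun_prop
  have hb : ContDiff ℝ 1 b := by fun_prop
  have hr : ContDiff ℝ 1 r := by fun_prop
  have hb1 : ∀ z, d1 b z = dotL c₂ (d1 N z) := by
    intro z
    have a2 := ((hasDerivAt_const z.1 c₂).dotL (hN.hasDerivAt_d1 z.1 z.2))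
    simpa using (hb.hasDerivAt_d1 z.1 z.2).unique a2
  have hb2 : ∀ z, d2 b z = dotL c₂ (d2 N z) := by
    intro z
    have a2 := ((hasDerivAt_const z.2 c₂).dotL (hN.hasDerivAt_d2 z.1 z.2))
    simpa using (hb.hasDerivAt_d2 z.1 z.2).unique a2
  have hcd1 : ∀ z, d1 M z - r z * d1 b z = dotL e (X z) * p z := by
    intro z
    have a1 := ((hasDerivAt_const z.1 c₁).dotL (hN.hasDerivAt_d1 z.1 z.2))
    have a2 := ((hasDerivAt_const z.1 c₂).dotL (hN.hasDerivAt_d1 z.1 z.2))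
    have a3 := ((hasDerivAt_const z.1 e).dotL (hu.hasDerivAt_d1 z.1 z.2))
    have eM := (hM.hasDerivAt_d1 z.1 z.2).unique ((a3.sub (a1.mul a2)).const_mul (1 / 2))
    have ec := contact_identity c₁ c₂ (N z) (d1 u z) (d1 N z)
    rw [h1, ← he, map_smul, smul_eq_mul] at ec
    simp only [map_zero, _root_.zero_apply, add_zero, Prod.mk.eta] at eM
    rw [hb1, eM]
    simp only [r]
    linarith
  have hcd2 : ∀ z, d2 M z - r z * d2 b z = dotL e (X z) * q z := by
    intro z
    have a1 := ((hasDerivAt_const z.2 c₁).dotL (hN.hasDerivAt_d2 z.1 z.2))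
    have a2 := ((hasDerivAt_const z.2 c₂).dotL (hN.hasDerivAt_d2 z.1 z.2))
    have a3 := ((hasDerivAt_const z.2 e).dotL (hu.hasDerivAt_d2 z.1 z.2))
    have eM := (hM.hasDerivAt_d2 z.1 z.2).unique ((a3.sub (a1.mul a2)).const_mul (1 / 2))
    have ec := contact_identity c₁ c₂ (N z) (d2 u z) (d2 N z)
    rw [h2, ← he, map_smul, smul_eq_mul] at ec
    simp only [map_zero, _root_.zero_apply, add_zero, Prod.mk.eta] at eM
    rw [hb2, eM]
    simp only [r]
    linarith
  let Ψ : ℝ × ℝ → ℝ × ℝ := fun z => (M z, b z)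
  have hΨ : ContDiff ℝ 1 Ψ := hM.prodMk hb
  have hΨ' : ∀ z, HasFDerivAt Ψ ((fderiv ℝ M z).prod (fderiv ℝ b z)) z := fun z =>
    (hM.hasFDerivAt_one z).prodMk (hb.hasFDerivAt_one z)
  have hdet : jacDet Ψ z₀ ≠ 0 := by
    have hc0' := mul_pos he0 hc0
    have e1 : d1 Ψ z₀ = (d1 M z₀, d1 b z₀) := by rw [d1, (hΨ' z₀).fderiv]; rfl
    have e2 : d2 Ψ z₀ = (d2 M z₀, d2 b z₀) := by rw [d2, (hΨ' z₀).fderiv]; rfl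
    have e3 := hcd1 z₀
    have e4 := hcd2 z₀
    rw [map_sub, map_smul, map_smul, ← hb1, ← hb2] at hc0'
    simp only [smul_eq_mul] at hc0'
    rw [jacDet, e1, e2]
    refine ne_of_gt (lt_of_lt_of_eq hc0' ?_)
    simp only
    linear_combination (-d2 b z₀) * e3 + d1 b z₀ * e4
  obtain ⟨Γ, hΓ, hΓ0, hΨΓ, hΓΨ⟩ := exists_contDiff_local_inverse hΨ hdet
  let lam : ℝ × ℝ → ℝ × ℝ → ℝ := fun y v =>
    (fderiv ℝ Γ y v).1 * p (Γ y) + (fderiv ℝ Γ y v).2 * q (Γ y)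
  have hlam : ∀ᶠ y in 𝓝 (Ψ z₀), ∀ v, dotL e (X (Γ y)) * lam y v = v.1 - r (Γ y) * v.2 := by
    filter_upwards [hΨΓ.eventually_nhds] with y hy v
    have f1 : fderiv ℝ (fun y => M (Γ y)) y v = v.1 := by
      have : (fun y => M (Γ y)) =ᶠ[𝓝 y] Prod.fst := hy.mono fun y' hy' => congrArg Prod.fst hy'
      rw [this.fderiv_eq, fderiv_fst]; rfl
    have f2 : fderiv ℝ (fun y => b (Γ y)) y v = v.2 := by
      have : (fun y => b (Γ y)) =ᶠ[𝓝 y] Prod.snd := hy.mono fun y' hy' => congrArg Prod.snd hy'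
      rw [this.fderiv_eq, fderiv_snd]; rfl
    rw [fderiv_comp_plane hM hΓ] at f1
    rw [fderiv_comp_plane hb hΓ] at f2
    simp only [smul_eq_mul] at f1 f2
    simp only [lam]
    linear_combination f1 - r (Γ y) * f2 - (fderiv ℝ Γ y v).1 * hcd1 (Γ y) -
      (fderiv ℝ Γ y v).2 * hcd2 (Γ y)
  have hpos : ∀ᶠ y in 𝓝 (Ψ z₀), 0 < dotL e (X (Γ y)) := by
    have cont : Continuous fun y => dotL e (X (Γ y)) := by
      have := hΓ.continuous
      fun_prop
    refine cont.continuousAt.eventually (lt_mem_nhds ?_)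
    simpa only [hΓ0] using he0
  obtain ⟨ε, hε, hbox⟩ := Metric.eventually_nhds_iff_ball.1 (hlam.and hpos)
  rw [← ball_prod_same, Real.ball_eq_Ioo, Real.ball_eq_Ioo] at hbox
  have hu' : ContDiff ℝ 1 fun y => u (Γ y) := hu.comp hΓ
  have hN' : ContDiff ℝ 1 fun y => N (Γ y) := hN.comp hΓ
  have hr' : ContDiff ℝ 1 fun y => r (Γ y) := hr.comp hΓ
  have cu1 := hu'.continuous_d1
  have cu2 := hu'.continuous_d2
  have cN := hN'.continuous
  have cN1 := hN'.continuous_d1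
  have cN2 := hN'.continuous_d2
  let V : ℝ × ℝ → Fin 3 → ℝ := fun y => (1 / 2 : ℝ) • (d1 (fun y => u (Γ y)) y +
    crossL (N (Γ y)) (d1 (fun y => N (Γ y)) y))
  let W : ℝ × ℝ → Fin 3 → ℝ := fun y => (1 / 2 : ℝ) • (d2 (fun y => u (Γ y)) y +
    crossL (N (Γ y)) (d2 (fun y => N (Γ y)) y))
  let Z : ℝ × ℝ → Fin 3 → ℝ := fun y =>
    -crossL (d1 (fun y => N (Γ y)) y) (d2 (fun y => N (Γ y)) y)
  have hV : ∀ y, V y = lam y (1, 0) • X (Γ y) := by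
    intro y
    simp only [V, d1]
    rw [asymptotic_comp hu hN hΓ h1 h2 y, smul_smul]
    congr 1
    simp only [lam]; ring
  have hW : ∀ y, W y = lam y (0, 1) • X (Γ y) := by
    intro y
    simp only [W, d2]
    rw [asymptotic_comp hu hN hΓ h1 h2 y, smul_smul]
    congr 1
    simp only [lam]; ring
  have cV : Continuous V := by fun_prop
  have cr' := hr'.continuous
  let c : ℝ := 1 / (dotL e e + 1)
  have hee := dotL_self_nonneg e
  have hc : 0 < c := by positivity
  have hce : c * dotL e e ≤ 1 := by
    simp only [c]
    rw [div_mul_eq_mul_div, one_mul, div_le_one (by linarith)]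
    linarith
  have hdefect := fun x hx y hy => rectDefect_length_eq_zero (V := V) (W := W) (Z := Z)
    (r := fun y => r (Γ y)) (e := e) cV (by fun_prop) (by fun_prop) hr'
    (fun x₁ x₂ y => hasDerivAt_integral_asymptotic hu' hN' x₁ x₂ y)
    (fun y hy => ?_) (fun y hy => ?_) (fun y _ => ?_) hc hce
    (a₁ := (Ψ z₀).1 - ε) (a₂ := (Ψ z₀).1 + ε) (b₁ := (Ψ z₀).2 - ε) (b₂ := (Ψ z₀).2 + ε)
    (x₁ := (Ψ z₀).1) (y₁ := (Ψ z₀).2) (x₂ := x) (y₂ := y)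
    ⟨by linarith, by linarith⟩ hx ⟨by linarith, by linarith⟩ hy
  · obtain ⟨s, hs⟩ := exists_primitive_of_rectDefect
      ((continuous_lengthAbove c).comp cV) (by
        have := (continuous_lengthAbove c).comp cV
        simp only [Function.comp_def] at this
        fun_prop) isOpen_Ioo isOpen_Ioo _ _ hdefect
    refine ⟨fun z => s (Ψ z), ?_⟩
    have hnear : ∀ᶠ z in 𝓝 z₀, Ψ z ∈ Ioo ((Ψ z₀).1 - ε) ((Ψ z₀).1 + ε) ×ˢ
        Ioo ((Ψ z₀).2 - ε) ((Ψ z₀).2 + ε) :=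
      hΨ.continuous.continuousAt.eventually ((isOpen_Ioo.prod isOpen_Ioo).mem_nhds
        ⟨⟨by linarith, by linarith⟩, by linarith, by linarith⟩)
    filter_upwards [hnear, hΓΨ] with z hz hΓz
    have hcomp : HasFDerivAt (fun z => s (Ψ z)) _ z := (hs (Ψ z) hz).comp z (hΨ' z)
    obtain ⟨hl, hpz⟩ := hbox (Ψ z) hz
    have hl1 := hl (1, 0)
    rw [hΓz] at hl1 hpz
    simp only [mul_zero, sub_zero] at hl1
    have hlpos : 0 < lam (Ψ z) (1, 0) := by
      by_contra! hcon
      nlinarith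
    have hVz : dotL (V (Ψ z)) e = 1 := by
      rw [hV, hΓz, map_smul, _root_.smul_apply, smul_eq_mul, dotL_comm, mul_comm, hl1]
    have hlen : lengthAbove c (V (Ψ z)) = lam (Ψ z) (1, 0) := by
      rw [lengthAbove, max_eq_left (le_dotL_self_of_dotL_eq_one hce hVz), hV, hΓz]
      simp only [map_smul, _root_.smul_apply, smul_eq_mul, hXX, mul_one]
      rw [← sq, Real.sqrt_sq hlpos.le]
    refine hcomp.congr_fderiv ?_
    rw [← covec_eq (ContinuousLinearMap.comp _ _)]
    have g1 := hcd1 z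
    have g2 := hcd2 z
    have k1 : (fderiv ℝ M z) (1, 0) = d1 M z := rfl
    have k2 : (fderiv ℝ M z) (0, 1) = d2 M z := rfl
    have k3 : (fderiv ℝ b z) (1, 0) = d1 b z := rfl
    have k4 : (fderiv ℝ b z) (0, 1) = d2 b z := rfl
    congr 1
    · simp [hlen, hΓz, k1, k3]
      linear_combination lam (Ψ z) (1, 0) * g1 + p z * hl1
    · simp [hlen, hΓz, k2, k4]
      linear_combination lam (Ψ z) (1, 0) * g2 + q z * hl1
  · obtain ⟨hl, hpz⟩ := hbox y hy
    have l1 := hl (1, 0)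
    have l2 := hl (0, 1)
    simp only [mul_zero, sub_zero, mul_one, zero_sub] at l1 l2
    rw [hW, hV, smul_smul, ← neg_smul]
    congr 1
    refine mul_left_cancel₀ hpz.ne' ?_
    linear_combination l2 + r (Γ y) * l1
  · obtain ⟨hl, hpz⟩ := hbox y hy
    have l1 := hl (1, 0)
    rw [hV, map_smul, _root_.smul_apply, smul_eq_mul, dotL_comm, mul_comm, l1]
    simp
  · rw [hV]
    simp only [Z, map_neg, map_smul, _root_.smul_apply, smul_eq_mul]
    rw [triple_eq_zero_of_orthogonal (hNN (Γ y)) (hXN _)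
      (d1_orthogonal_of_unit hN' (fun y => hNN (Γ y)) y)
      (d2_orthogonal_of_unit hN' (fun y => hNN (Γ y)) y)]
    simp

end LocalClosedness

section GlobalChart

variable {F A B : ℝ × ℝ → ℝ × ℝ}

/-- A plane map all of whose derivatives are invertible is, uniformly over a compact set, invertible
on balls of a fixed radius. -/
theorem exists_uniform_sections (hF : ContDiff ℝ 1 F) (hJ : ∀ z, jacDet F z ≠ 0) {K : Set (ℝ × ℝ)}
    (hK : IsCompact K) : ∃ δ > 0, ∀ p ∈ K, ∃ g : ℝ × ℝ → ℝ × ℝ,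
      ContinuousOn g (Metric.ball (F p) δ) ∧ g (F p) = p ∧
      ∀ y ∈ Metric.ball (F p) δ, F (g y) = y := by
  refine hK.induction_on ⟨1, one_pos, by simp⟩ ?_ ?_ ?_
  · intro _ _ hst ht
    obtain ⟨δ, hδ, h⟩ := ht
    exact ⟨δ, hδ, fun p hp => h p (hst hp)⟩
  · intro s t hs ht
    obtain ⟨δ, hδ, h⟩ := hs
    obtain ⟨ε, hε, k⟩ := ht
    refine ⟨min δ ε, lt_min hδ hε, ?_⟩
    rintro p (hp | hp)
    · obtain ⟨g, hg, hgp, hgy⟩ := h p hp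
      have hsub := Metric.ball_subset_ball (x := F p) (min_le_left δ ε)
      exact ⟨g, hg.mono hsub, hgp, fun y hy => hgy y (hsub hy)⟩
    · obtain ⟨g, hg, hgp, hgy⟩ := k p hp
      have hsub := Metric.ball_subset_ball (x := F p) (min_le_right δ ε)
      exact ⟨g, hg.mono hsub, hgp, fun y hy => hgy y (hsub hy)⟩
  · intro p₀ _
    obtain ⟨Φ, hz, hΦF, -⟩ := exists_openPartialHomeomorph hF (hJ p₀)
    have hmap : F p₀ ∈ Φ.target := by rw [← hΦF]; exact Φ.map_source hz
    obtain ⟨ε, hε, hball⟩ := Metric.isOpen_iff.1 Φ.open_target _ hmap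
    refine ⟨Φ.source ∩ F ⁻¹' Metric.ball (F p₀) (ε / 2), mem_nhdsWithin_of_mem_nhds
      (inter_mem (Φ.open_source.mem_nhds hz) (hF.continuous.continuousAt.preimage_mem_nhds
        (Metric.ball_mem_nhds _ (half_pos hε)))), ε / 2, half_pos hε, ?_⟩
    rintro p ⟨hps, hpb⟩
    have hsub : Metric.ball (F p) (ε / 2) ⊆ Φ.target := by
      refine (Metric.ball_subset_ball' ?_).trans hball
      have := Metric.mem_ball.1 hpb
      linarith
    refine ⟨Φ.symm, Φ.continuousOn_symm.mono hsub, ?_, fun y hy => ?_⟩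
    · rw [← hΦF]; exact Φ.left_inv hps
    · rw [← hΦF]; exact Φ.right_inv (hsub hy)

theorem jacDet_ne_zero_of_frame (hA : ∀ z, fderiv ℝ F z (A z) = (1, 0))
    (hB : ∀ z, fderiv ℝ F z (B z) = (0, 1)) (z : ℝ × ℝ) : jacDet F z ≠ 0 := by
  intro h
  have h1 := hA z
  have h2 := hB z
  rw [clm_prod_apply, Prod.ext_iff] at h1 h2
  simp only [jacDet, d1, d2] at h
  simp at h1 h2
  obtain ⟨a1, a2⟩ := h1
  obtain ⟨b1, b2⟩ := h2
  have : ((fderiv ℝ F z (1, 0)).1 * (fderiv ℝ F z (0, 1)).2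
      - (fderiv ℝ F z (1, 0)).2 * (fderiv ℝ F z (0, 1)).1)
      * ((A z).1 * (B z).2 - (A z).2 * (B z).1) = 1 := by
    linear_combination ((B z).1 * (fderiv ℝ F z (1, 0)).2 + (B z).2 * (fderiv ℝ F z (0, 1)).2) * a1
      + b2 - ((A z).1 * (fderiv ℝ F z (1, 0)).2 + (A z).2 * (fderiv ℝ F z (0, 1)).2) * b1
  rw [h, zero_mul] at this
  exact zero_ne_one this

theorem exists_equiv_of_frame (hA : ∀ z, fderiv ℝ F z (A z) = (1, 0))
    (hB : ∀ z, fderiv ℝ F z (B z) = (0, 1)) (z : ℝ × ℝ) :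
    ∃ e : (ℝ × ℝ) ≃L[ℝ] (ℝ × ℝ), (e : ℝ × ℝ →L[ℝ] ℝ × ℝ) = fderiv ℝ F z ∧
      (e.symm : ℝ × ℝ →L[ℝ] ℝ × ℝ) = covec (A z) (B z) := by
  obtain ⟨e, he⟩ := exists_equiv_of_jacDet_ne_zero (jacDet_ne_zero_of_frame hA hB z)
  refine ⟨e, he, ?_⟩
  ext1 <;> ext1
  all_goals
    apply e.injective
    have hc : ∀ v, e v = fderiv ℝ F z v := fun v => by rw [← he]; rfl
    simp [hc (A z), hc (B z), hA, hB]

theorem hasDerivWithinAt_ray_lift (hF : ContDiff ℝ 1 F)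
    (hA : ∀ z, fderiv ℝ F z (A z) = (1, 0)) (hB : ∀ z, fderiv ℝ F z (B z) = (0, 1))
    {w : ℝ × ℝ} {γ : ℝ → ℝ × ℝ} (hγ : Continuous γ) {τ : ℝ}
    (hlift : ∀ ρ ∈ Icc 0 τ, F (γ ρ) = ρ • w) {ρ : ℝ} (hρ : ρ ∈ Icc 0 τ) :
    HasDerivWithinAt γ (w.1 • A (γ ρ) + w.2 • B (γ ρ)) (Icc 0 τ) ρ := by
  obtain ⟨e, he, hes⟩ := exists_equiv_of_frame hA hB (γ ρ)
  have hd : HasFDerivWithinAt F (e : ℝ × ℝ →L[ℝ] ℝ × ℝ) univ (γ ρ) := by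
    rw [he]; exact (hF.hasFDerivAt_one _).hasFDerivWithinAt
  have hh : HasDerivWithinAt (fun ρ : ℝ => ρ • w) w (Icc 0 τ) ρ := by
    simpa using ((hasDerivAt_id ρ).smul_const w).hasDerivWithinAt
  have := HasFDerivWithinAt.of_comp_of_leftInverse (f'symm := (e.symm : ℝ × ℝ →L[ℝ] ℝ × ℝ))
    (by rw [nhdsWithin_univ]; exact hγ.continuousAt.continuousWithinAt) hd hh.hasFDerivWithinAt
    (eventually_mem_nhdsWithin.mono hlift) e.symm_apply_apply hρ
  have h2 := this.hasDerivWithinAt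
  rw [hes] at h2
  simpa using h2

theorem ray_lift_mem (hF : ContDiff ℝ 1 F)
    (hA : ∀ z, fderiv ℝ F z (A z) = (1, 0)) (hB : ∀ z, fderiv ℝ F z (B z) = (0, 1))
    (hA1 : ∀ z, |(A z).1| ≤ Real.exp z.2) (hA2 : ∀ z, |(A z).2| ≤ 1)
    (hB1 : ∀ z, |(B z).1| ≤ Real.exp z.2) (hB2 : ∀ z, |(B z).2| ≤ 1)
    {w : ℝ × ℝ} {γ : ℝ → ℝ × ℝ} (hγ : Continuous γ) (h0 : γ 0 = 0) {τ : ℝ} (hτ1 : τ ≤ 1)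
    (hlift : ∀ ρ ∈ Icc 0 τ, F (γ ρ) = ρ • w) {ρ : ℝ} (hρ : ρ ∈ Icc 0 τ) :
    γ ρ ∈ Metric.closedBall (0 : ℝ × ℝ) ((|w.1| + |w.2|) * Real.exp (|w.1| + |w.2|)) := by
  set C := |w.1| + |w.2| with hC
  have hC0 : 0 ≤ C := by positivity
  have hd := fun ρ hρ => hasDerivWithinAt_ray_lift hF hA hB hγ hlift (ρ := ρ) hρ
  have hcomb : ∀ a b M : ℝ, |a| ≤ M → |b| ≤ M → |w.1 * a + w.2 * b| ≤ C * M := by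
    intro a b M ha hb
    calc |w.1 * a + w.2 * b| ≤ |w.1 * a| + |w.2 * b| := abs_add_le _ _
      _ = |w.1| * |a| + |w.2| * |b| := by rw [abs_mul, abs_mul]
      _ ≤ |w.1| * M + |w.2| * M := by gcongr
      _ = C * M := by rw [hC]; ring
  have h2 : ∀ ρ ∈ Icc 0 τ, |(γ ρ).2| ≤ C := by
    intro ρ hρ
    have := norm_image_sub_le_of_norm_deriv_le_segment' (f := fun ρ => (γ ρ).2) (C := C)
      (fun x hx => (hasFDerivAt_snd.comp_hasDerivWithinAt x (hd x hx)))
      (fun x _ => by simpa using hcomb _ _ 1 (hA2 (γ x)) (hB2 (γ x))) ρ hρ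
    simp only [h0, Prod.snd_zero, sub_zero, Real.norm_eq_abs] at this
    exact this.trans (by nlinarith [hρ.1, hρ.2])
  have h1 : ∀ ρ ∈ Icc 0 τ, |(γ ρ).1| ≤ C * Real.exp C := by
    intro ρ hρ
    have := norm_image_sub_le_of_norm_deriv_le_segment' (f := fun ρ => (γ ρ).1)
      (C := C * Real.exp C)
      (fun x hx => (hasFDerivAt_fst.comp_hasDerivWithinAt x (hd x hx)))
      (fun x hx => by
        have hle : Real.exp (γ x).2 ≤ Real.exp C :=
          Real.exp_le_exp.2 ((le_abs_self _).trans (h2 x (Ico_subset_Icc_self hx)))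
        simpa using hcomb _ _ _ ((hA1 (γ x)).trans hle) ((hB1 (γ x)).trans hle)) ρ hρ
    simp only [h0, Prod.fst_zero, sub_zero, Real.norm_eq_abs] at this
    have hpos : 0 ≤ C * Real.exp C := by positivity
    exact this.trans (by nlinarith [hρ.1, hρ.2])
  rw [mem_closedBall_zero_iff, Prod.norm_def]
  refine max_le (h1 ρ hρ) ((h2 ρ hρ).trans ?_)
  have := Real.add_one_le_exp C
  nlinarith

theorem exists_ray_lift (hF : ContDiff ℝ 1 F) (hF0 : F 0 = 0)
    (hA : ∀ z, fderiv ℝ F z (A z) = (1, 0)) (hB : ∀ z, fderiv ℝ F z (B z) = (0, 1))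
    (hA1 : ∀ z, |(A z).1| ≤ Real.exp z.2) (hA2 : ∀ z, |(A z).2| ≤ 1)
    (hB1 : ∀ z, |(B z).1| ≤ Real.exp z.2) (hB2 : ∀ z, |(B z).2| ≤ 1) (w : ℝ × ℝ) :
    ∃ γ : ℝ → ℝ × ℝ, Continuous γ ∧ γ 0 = 0 ∧ ∀ ρ ∈ Icc (0 : ℝ) 1, F (γ ρ) = ρ • w := by
  obtain ⟨δ, hδ, hsec⟩ := exists_uniform_sections hF (jacDet_ne_zero_of_frame hA hB)
    (isCompact_closedBall (0 : ℝ × ℝ) ((|w.1| + |w.2|) * Real.exp (|w.1| + |w.2|)))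
  obtain ⟨h, hh, hhδ⟩ : ∃ h : ℝ, 0 < h ∧ h * ‖w‖ < δ := by
    refine ⟨δ / (‖w‖ + 1), by positivity, ?_⟩
    rw [div_mul_eq_mul_div, div_lt_iff₀ (by positivity)]
    nlinarith [norm_nonneg w]
  have step : ∀ n : ℕ, ∃ γ : ℝ → ℝ × ℝ, Continuous γ ∧ γ 0 = 0 ∧
      ∀ ρ ∈ Icc (0 : ℝ) (min (n * h) 1), F (γ ρ) = ρ • w := by
    intro n
    induction n with
    | zero =>
      refine ⟨fun _ => 0, continuous_const, rfl, fun ρ hρ => ?_⟩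
      have : ρ = 0 := by
        have := hρ.2
        simp at this
        exact le_antisymm this hρ.1
      simp [this, hF0]
    | succ n ih =>
      obtain ⟨γ, hγ, h0, hl⟩ := ih
      set τ := min (n * h) 1 with hτ
      have hτ0 : 0 ≤ τ := le_min (by positivity) zero_le_one
      obtain ⟨g, hg, hgp, hgy⟩ := hsec (γ τ) (ray_lift_mem hF hA hB hA1 hA2 hB1 hB2 hγ h0
        (min_le_right _ _) hl (right_mem_Icc.2 hτ0))
      rw [hl τ (right_mem_Icc.2 hτ0)] at hg hgp hgy
      have hmem : ∀ ρ : ℝ, max τ (min ρ (τ + h)) • w ∈ Metric.ball (τ • w) δ := by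
        intro ρ
        rw [Metric.mem_ball, dist_eq_norm, ← sub_smul, norm_smul, Real.norm_eq_abs]
        refine lt_of_le_of_lt (mul_le_mul_of_nonneg_right ?_ (norm_nonneg w)) hhδ
        rw [abs_of_nonneg (sub_nonneg.2 (le_max_left _ _)), sub_le_iff_le_add']
        exact max_le (by linarith) (min_le_right _ _)
      refine ⟨fun ρ => if ρ ≤ τ then γ ρ else g (max τ (min ρ (τ + h)) • w), ?_, ?_, ?_⟩
      · refine Continuous.if_le hγ (hg.comp_continuous (by fun_prop) hmem) continuous_id
          continuous_const ?_
        rintro ρ rfl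
        rw [min_eq_left (by linarith), max_self, hgp]
      · simp [hτ0, h0]
      · rintro ρ ⟨hρ0, hρ⟩
        simp only
        split_ifs with hc
        · exact hl ρ ⟨hρ0, hc⟩
        · push Not at hc
          have hle : ρ ≤ τ + h := by
            have h1 := hρ.trans (min_le_left _ _)
            have h2 := hρ.trans (min_le_right _ _)
            push_cast at h1
            rw [hτ, ← sub_le_iff_le_add]
            exact le_min (by linarith) (by linarith)
          rw [hgy _ (hmem ρ), min_eq_left hle, max_eq_right hc.le]
  obtain ⟨n, hn⟩ := exists_nat_gt (1 / h)
  obtain ⟨γ, hγ, h0, hl⟩ := step n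
  refine ⟨γ, hγ, h0, ?_⟩
  rw [div_lt_iff₀ hh] at hn
  rwa [min_eq_right hn.le] at hl

/-- A plane map whose inverse derivative has controlled growth admits a global section. -/
theorem exists_global_chart (hF : ContDiff ℝ 1 F) (hF0 : F 0 = 0)
    (hAc : Continuous A) (hBc : Continuous B)
    (hA : ∀ z, fderiv ℝ F z (A z) = (1, 0)) (hB : ∀ z, fderiv ℝ F z (B z) = (0, 1))
    (hA1 : ∀ z, |(A z).1| ≤ Real.exp z.2) (hA2 : ∀ z, |(A z).2| ≤ 1)
    (hB1 : ∀ z, |(B z).1| ≤ Real.exp z.2) (hB2 : ∀ z, |(B z).2| ≤ 1) :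
    ∃ G : ℝ × ℝ → ℝ × ℝ, ContDiff ℝ 1 G ∧ (∀ y, d1 G y = A (G y)) ∧ ∀ y, d2 G y = B (G y) := by
  choose γ hγ h0 hl using exists_ray_lift hF hF0 hA hB hA1 hA2 hB1 hB2
  have homeo : IsLocalHomeomorph F := by
    refine IsLocalHomeomorph.mk F fun z => ?_
    obtain ⟨Φ, hz, hΦF, -⟩ := exists_openPartialHomeomorph hF (jacDet_ne_zero_of_frame hA hB z)
    exact ⟨Φ, hz, fun y _ => by rw [hΦF]⟩
  have hcont : Continuous fun x : unitInterval × (ℝ × ℝ) => γ x.2 x.1 := by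
    refine IsLocalHomeomorph.continuous_lift homeo (T2Space.isSeparatedMap _)
      ⟨fun x : unitInterval × (ℝ × ℝ) => (x.1 : ℝ) • x.2, by fun_prop⟩ ?_ ?_ ?_
    · ext1 x
      exact hl x.2 x.1 x.1.2
    · simp only [Icc.coe_zero, h0]
      exact continuous_const
    · intro w
      exact (hγ w).comp continuous_subtype_val
  set G : ℝ × ℝ → ℝ × ℝ := fun w => γ w 1 with hG
  have hGc : Continuous G := hcont.comp (Continuous.prodMk_right (1 : unitInterval))
  have hFG : ∀ y, F (G y) = y := fun y => by simpa using hl y 1 (right_mem_Icc.2 zero_le_one)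
  have hd : ∀ y, HasFDerivAt G (covec (A (G y)) (B (G y))) y := by
    intro y
    obtain ⟨e, he, hes⟩ := exists_equiv_of_frame hA hB (G y)
    rw [← hes]
    refine HasFDerivAt.of_local_left_inverse hGc.continuousAt ?_ (Eventually.of_forall hFG)
    rw [he]
    exact hF.hasFDerivAt_one _
  refine ⟨G, contDiff_one_of_hasFDerivAt hd ((hAc.comp hGc).covec (hBc.comp hGc)), ?_, ?_⟩ <;>
  · intro y
    simp [d1, d2, (hd y).fderiv]

end GlobalChart

section AsymptoticAngles

theorem exists_continuous_polar_angle {c d r : ℝ × ℝ → ℝ} (hc : Continuous c) (hd : Continuous d)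
    (hr : ∀ z, 0 < r z) (h : ∀ z, c z ^ 2 + d z ^ 2 = r z ^ 2) :
    ∃ φ : ℝ × ℝ → ℝ, Continuous φ ∧ ∀ z, c z = r z * Real.cos (φ z) ∧
      d z = r z * Real.sin (φ z) := by
  have hg : Continuous fun z => (⟨c z, d z⟩ : ℂ) := by
    have : (fun z => (⟨c z, d z⟩ : ℂ)) = fun z => (c z : ℂ) + d z * Complex.I := by
      ext z
      apply Complex.ext <;> simp
    rw [this]
    fun_prop
  obtain ⟨f, hf, hfg⟩ := Complex.exists_continuousOn_eqOn_exp_comp (U := (univ : Set (ℝ × ℝ)))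
    ((Homeomorph.Set.univ _).toHomotopyEquiv.simplyConnectedSpace_iff.2 inferInstance) isOpen_univ hg.continuousOn (by
      rintro ⟨z, -, hz⟩
      have h1 := congrArg Complex.re hz
      have h2 := congrArg Complex.im hz
      simp at h1 h2
      have h3 := h z
      rw [h1, h2] at h3
      exact (pow_pos (hr z) 2).ne (by simpa using h3))
  refine ⟨fun z => (f z).im, Complex.continuous_im.comp (continuousOn_univ.1 hf), fun z => ?_⟩
  have hz := hfg (mem_univ z)
  have h1 := congrArg Complex.re hz
  have h2 := congrArg Complex.im hz
  simp only [Function.comp_apply, Complex.exp_re, Complex.exp_im] at h1 h2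
  have hre : Real.exp (f z).re = r z := by
    refine (sq_eq_sq₀ (Real.exp_pos _).le (hr z).le).1 ?_
    rw [← h z, ← h1, ← h2]
    linear_combination -Real.exp (f z).re ^ 2 * Real.sin_sq_add_cos_sq (f z).im
  rw [← hre, h1, h2]
  exact ⟨rfl, rfl⟩

/-- A continuous field of symmetric forms of determinant `-1` on the plane has a continuous pair of
isotropic directions, with angles `α` and `β`. -/
theorem exists_asymptotic_angles {h₁₁ h₁₂ h₂₂ : ℝ × ℝ → ℝ} (c₁₁ : Continuous h₁₁)
    (c₁₂ : Continuous h₁₂) (c₂₂ : Continuous h₂₂)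
    (hdet : ∀ z, h₁₁ z * h₂₂ z - h₁₂ z ^ 2 = -1) :
    ∃ α β : ℝ × ℝ → ℝ, Continuous α ∧ Continuous β ∧
      (∀ z, 0 < β z - α z) ∧ (∀ z, β z - α z < Real.pi) ∧
      ∀ z, h₁₁ z * Real.sin (β z - α z) = -2 * Real.sin (α z) * Real.sin (β z) ∧
        h₂₂ z * Real.sin (β z - α z) = -2 * Real.cos (α z) * Real.cos (β z) ∧
        h₁₂ z * Real.sin (β z - α z) = Real.sin (α z + β z) := by
  set m : ℝ × ℝ → ℝ := fun z => (h₁₁ z + h₂₂ z) / 2 with hm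
  set r : ℝ × ℝ → ℝ := fun z => √(m z ^ 2 + 1) with hr
  have hmc : Continuous m := by fun_prop
  have hrc : Continuous r := by fun_prop
  have hrpos : ∀ z, 0 < r z := fun z => Real.sqrt_pos.2 (by positivity)
  have hrsq : ∀ z, r z ^ 2 = m z ^ 2 + 1 := fun z => Real.sq_sqrt (by positivity)
  obtain ⟨φ, hφ, hφz⟩ := exists_continuous_polar_angle (c := fun z => (h₁₁ z - h₂₂ z) / 2)
    (d := h₁₂) (by fun_prop) c₁₂ hrpos (fun z => by
      rw [hrsq]; simp only [hm]; linear_combination -hdet z)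
  set χ : ℝ × ℝ → ℝ := fun z => Real.arccos (-m z / r z) with hχ
  have hχc : Continuous χ := Real.continuous_arccos.comp
    (hmc.neg.div hrc fun z => (hrpos z).ne')
  have hlt : ∀ z, |m z| < r z := fun z => by
    rw [← abs_of_pos (hrpos z), ← sq_lt_sq, hrsq]
    linarith
  have hcos : ∀ z, r z * Real.cos (χ z) = -m z := fun z => by
    have h := abs_lt.1 (hlt z)
    rw [hχ, Real.cos_arccos, mul_div_cancel₀ _ (hrpos z).ne']
    · rw [le_div_iff₀ (hrpos z)]; linarith
    · rw [div_le_iff₀ (hrpos z)]; linarith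
  have h0 : ∀ z, 0 < χ z := fun z => by
    rw [hχ, Real.arccos_pos, div_lt_one (hrpos z)]
    linarith [(abs_lt.1 (hlt z)).1]
  have hπ : ∀ z, χ z < Real.pi := fun z => by
    refine lt_of_le_of_ne (Real.arccos_le_pi _) fun h => ?_
    have := hcos z
    rw [h, Real.cos_pi] at this
    linarith [(abs_lt.1 (hlt z)).2]
  have hsin : ∀ z, r z * Real.sin (χ z) = 1 := fun z => by
    have hs := Real.sin_pos_of_pos_of_lt_pi (h0 z) (hπ z)
    refine (sq_eq_sq₀ (mul_pos (hrpos z) hs).le zero_le_one).1 ?_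
    have := hcos z
    linear_combination r z ^ 2 * Real.sin_sq_add_cos_sq (χ z) - (r z * Real.cos (χ z) - m z) * this
      + hrsq z
  refine ⟨fun z => (φ z - χ z) / 2, fun z => (φ z + χ z) / 2, by fun_prop, by fun_prop,
    fun z => ?_, fun z => ?_, fun z => ?_⟩
  · linarith [h0 z]
  · linarith [hπ z]
  have e1 : (φ z + χ z) / 2 - (φ z - χ z) / 2 = χ z := by ring
  have e2 : (φ z - χ z) / 2 + (φ z + χ z) / 2 = φ z := by ring
  have hs := hsin z
  have hc := hcos z
  obtain ⟨hφ1, hφ2⟩ := hφz z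
  have k1 := Real.cos_sub ((φ z + χ z) / 2) ((φ z - χ z) / 2)
  have k2 := Real.cos_add ((φ z - χ z) / 2) ((φ z + χ z) / 2)
  rw [e1] at k1
  rw [e2] at k2
  simp only [e1, e2]
  have hh1 : h₁₁ z = r z * (Real.cos (φ z) - Real.cos (χ z)) := by
    simp only [hm] at hc
    linear_combination hφ1 + hc
  have hh2 : h₂₂ z = -r z * (Real.cos (φ z) + Real.cos (χ z)) := by
    simp only [hm] at hc
    linear_combination -hφ1 + hc
  refine ⟨?_, ?_, ?_⟩
  · rw [hh1]
    linear_combination (Real.cos (φ z) - Real.cos (χ z)) * hs + k2 - k1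
  · rw [hh2]
    linear_combination (-Real.cos (φ z) - Real.cos (χ z)) * hs - k2 - k1
  · rw [hφ2]
    linear_combination Real.sin (φ z) * hs

end AsymptoticAngles

section Frames

theorem dotL_d1_of_const {f g : ℝ × ℝ → Fin 3 → ℝ} (hf : ContDiff ℝ 1 f) (hg : ContDiff ℝ 1 g)
    {c : ℝ} (h : ∀ z, dotL (f z) (g z) = c) (z : ℝ × ℝ) :
    dotL (f z) (d1 g z) + dotL (d1 f z) (g z) = 0 := by
  have h' := (hf.hasDerivAt_d1 z.1 z.2).dotL (hg.hasDerivAt_d1 z.1 z.2)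
  simp only [h] at h'
  exact h'.unique (hasDerivAt_const _ _)

theorem dotL_d2_of_const {f g : ℝ × ℝ → Fin 3 → ℝ} (hf : ContDiff ℝ 1 f) (hg : ContDiff ℝ 1 g)
    {c : ℝ} (h : ∀ z, dotL (f z) (g z) = c) (z : ℝ × ℝ) :
    dotL (f z) (d2 g z) + dotL (d2 f z) (g z) = 0 := by
  have h' := (hf.hasDerivAt_d2 z.1 z.2).dotL (hg.hasDerivAt_d2 z.1 z.2)
  simp only [h] at h'
  exact h'.unique (hasDerivAt_const _ _)

theorem crossL_crossL_left (a b c : Fin 3 → ℝ) :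
    crossL (crossL a b) c = dotL a c • b - dotL b c • a := by
  ext i; fin_cases i <;> simp [crossL_apply, dotL_apply] <;> ring

/-- Expansion of a vector in an orthonormal frame completed by the cross product. -/
theorem eq_orthonormal_expansion {a b : Fin 3 → ℝ} (haa : dotL a a = 1) (hab : dotL a b = 0)
    (hbb : dotL b b = 1) (v : Fin 3 → ℝ) :
    v = dotL v a • a + dotL v b • b + dotL v (crossL a b) • crossL a b := by
  have h : (dotL a a * dotL b b - dotL a b * dotL a b) • v =
      dotL v a • (dotL b b • a - dotL a b • b) + dotL v b • (dotL a a • b - dotL a b • a)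
      + dotL v (crossL a b) • crossL a b := by
    ext i; fin_cases i <;> simp [crossL_apply, dotL_apply] <;> ring
  simpa [haa, hab, hbb] using h

/-- An orthonormal tangent frame `E₁ = e^v w_x`, `E₂ = w_v` along an immersion `w` of the hyperbolic
plane in the coordinates `(x, v)` for which the metric is `e^{-2v} dx² + dv²`. -/
structure DarbouxFrame (w E₁ E₂ : ℝ × ℝ → Fin 3 → ℝ) : Prop where
  contDiff : ContDiff ℝ 1 w
  contDiff₁ : ContDiff ℝ 1 E₁
  contDiff₂ : ContDiff ℝ 1 E₂
  inner₁₁ : ∀ z, dotL (E₁ z) (E₁ z) = 1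
  inner₁₂ : ∀ z, dotL (E₁ z) (E₂ z) = 0
  inner₂₂ : ∀ z, dotL (E₂ z) (E₂ z) = 1
  d1_eq : ∀ z, d1 w z = Real.exp (-z.2) • E₁ z
  d2_eq : ∀ z, d2 w z = E₂ z
  connection₁ : ∀ z, dotL (E₂ z) (d1 E₁ z) = Real.exp (-z.2)
  connection₂ : ∀ z, dotL (E₂ z) (d2 E₁ z) = 0
  symm : ∀ z, dotL (d1 E₂ z) (crossL (E₁ z) (E₂ z)) =
    Real.exp (-z.2) * dotL (d2 E₁ z) (crossL (E₁ z) (E₂ z))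

theorem d2_d1_comm {f : ℝ × ℝ → Fin 3 → ℝ} (hf : ContDiff ℝ 2 f) (z : ℝ × ℝ) :
    d2 (d1 f) z = d1 (d2 f) z := by
  have hd : DifferentiableAt ℝ (fderiv ℝ f) z :=
    (hf.fderiv_right (m := 1) (by norm_num)).differentiable one_ne_zero z
  have key : ∀ v w, fderiv ℝ (fun z => fderiv ℝ f z v) z w = fderiv ℝ (fderiv ℝ f) z w v := by
    intro v w
    rw [fderiv_clm_apply hd (differentiableAt_const v)]
    simp
  have hs : IsSymmSndFDerivAt ℝ f z := hf.contDiffAt.isSymmSndFDerivAt (by simp)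
  exact (key _ _).trans ((hs _ _).trans (key _ _).symm)

theorem exists_darbouxFrame {w : ℝ × ℝ → Fin 3 → ℝ} (hw : ContDiff ℝ 2 w)
    (h11 : ∀ z, dotL (d1 w z) (d1 w z) = Real.exp (-z.2) ^ 2)
    (h12 : ∀ z, dotL (d1 w z) (d2 w z) = 0) (h22 : ∀ z, dotL (d2 w z) (d2 w z) = 1) :
    ∃ E₁ E₂, DarbouxFrame w E₁ E₂ := by
  have hfd : ContDiff ℝ 1 (fderiv ℝ w) := hw.fderiv_right (by norm_num)
  have hc1 : ContDiff ℝ 1 (d1 w) := hfd.clm_apply contDiff_const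
  have hc2 : ContDiff ℝ 1 (d2 w) := hfd.clm_apply contDiff_const
  set E₁ : ℝ × ℝ → Fin 3 → ℝ := fun z => Real.exp z.2 • d1 w z with hE₁
  have hcE : ContDiff ℝ 1 E₁ := (Real.contDiff_exp.comp contDiff_snd).smul hc1
  have hexp : ∀ z : ℝ × ℝ, Real.exp (-z.2) * Real.exp z.2 = 1 := fun z => by
    rw [← Real.exp_add]; simp
  have i11 : ∀ z, dotL (E₁ z) (E₁ z) = 1 := fun z => by
    simp only [hE₁, map_smul, _root_.smul_apply, smul_eq_mul, h11]
    linear_combination (Real.exp (-z.2) * Real.exp z.2 + 1) * hexp z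
  have i12 : ∀ z, dotL (E₁ z) (d2 w z) = 0 := fun z => by
    simp [hE₁, h12]
  have hd : ∀ z, d2 E₁ z = E₁ z + Real.exp z.2 • d1 (d2 w) z := by
    intro z
    have h := (Real.hasDerivAt_exp z.2).smul (hc1.hasDerivAt_d2 z.1 z.2)
    rw [(hcE.hasDerivAt_d2 z.1 z.2).unique h, ← d2_d1_comm hw, add_comm]
  have o1 := dotL_d2_of_const hcE hcE i11
  have o2 := dotL_d1_of_const hc2 hc2 h22
  have o3 := dotL_d1_of_const hcE hc2 i12
  refine ⟨E₁, d2 w, hw.of_le (by norm_num), hcE, hc2, i11, i12, h22, fun z => ?_, fun z => rfl,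
    fun z => ?_, fun z => ?_, fun z => ?_⟩
  · simp [hE₁, smul_smul, hexp]
  · have a1 := o1 z
    rw [dotL_comm (d2 E₁ z), hd] at a1
    simp only [map_add, map_smul, i11, smul_eq_mul] at a1
    have a3 := o3 z
    rw [dotL_comm (d1 E₁ z)] at a3
    linear_combination a3 - Real.exp (-z.2) / 2 * a1 + dotL (E₁ z) (d1 (d2 w) z) * hexp z
  · have a2 := o2 z
    rw [dotL_comm (d1 (d2 w) z)] at a2
    rw [hd]
    simp only [map_add, map_smul, smul_eq_mul, dotL_comm (d2 w z) (E₁ z), i12]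
    linear_combination Real.exp z.2 / 2 * a2
  · rw [hd]
    simp only [map_add, _root_.add_apply, map_smul, _root_.smul_apply, smul_eq_mul,
      dotL_crossL_self_left]
    linear_combination -dotL (d1 (d2 w) z) (crossL (E₁ z) (d2 w z)) * hexp z

namespace DarbouxFrame

variable {w E₁ E₂ : ℝ × ℝ → Fin 3 → ℝ}

theorem neg (h : DarbouxFrame w E₁ E₂) :
    DarbouxFrame (fun z => -w z) (fun z => -E₁ z) (fun z => -E₂ z) := by
  have e1 : ∀ f : ℝ × ℝ → Fin 3 → ℝ, d1 (fun z => -f z) = fun z => -d1 f z := fun f => by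
    ext1 z; simp [d1, fderiv_fun_neg]
  have e2 : ∀ f : ℝ × ℝ → Fin 3 → ℝ, d2 (fun z => -f z) = fun z => -d2 f z := fun f => by
    ext1 z; simp [d2, fderiv_fun_neg]
  constructor
  · exact h.contDiff.neg
  · exact h.contDiff₁.neg
  · exact h.contDiff₂.neg
  · simpa using h.inner₁₁
  · simpa using h.inner₁₂
  · simpa using h.inner₂₂
  · intro z; simp [e1, h.d1_eq]
  · intro z; simp [e2, h.d2_eq]
  · intro z; simp [e1, h.connection₁]
  · intro z; simp [e2, h.connection₂]
  · intro z; simp [e1, e2, h.symm]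

theorem contDiff_normal (h : DarbouxFrame w E₁ E₂) :
    ContDiff ℝ 1 fun z => crossL (E₁ z) (E₂ z) :=
  (crossL.contDiff.comp h.contDiff₁).clm_apply h.contDiff₂

theorem normal_unit (h : DarbouxFrame w E₁ E₂) (z : ℝ × ℝ) :
    dotL (crossL (E₁ z) (E₂ z)) (crossL (E₁ z) (E₂ z)) = 1 := by
  rw [dotL_crossL_crossL, dotL_comm (E₂ z) (E₁ z), h.inner₁₁, h.inner₁₂, h.inner₂₂]
  norm_num

theorem dotL_d1_self₁ (h : DarbouxFrame w E₁ E₂) (z : ℝ × ℝ) : dotL (d1 E₁ z) (E₁ z) = 0 :=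
  d1_orthogonal_of_unit h.contDiff₁ h.inner₁₁ z

theorem dotL_d2_self₂ (h : DarbouxFrame w E₁ E₂) (z : ℝ × ℝ) : dotL (d2 E₂ z) (E₂ z) = 0 :=
  d2_orthogonal_of_unit h.contDiff₂ h.inner₂₂ z

/-- The differentiated form of Gauss's equation. -/
theorem dotL_d2_d1_sub (h : DarbouxFrame w E₁ E₂) (z : ℝ × ℝ) :
    dotL (d2 E₂ z) (d1 E₁ z) - dotL (d1 E₂ z) (d2 E₁ z) = -Real.exp (-z.2) := by
  obtain ⟨x, y⟩ := z
  set K : ℝ → ℝ := fun x =>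
    dotL (d2 E₂ (x, y)) (d1 E₁ (x, y)) - dotL (d1 E₂ (x, y)) (d2 E₁ (x, y)) with hK
  have hKc : Continuous K := by
    have c1 := h.contDiff₁.continuous_d1
    have c2 := h.contDiff₁.continuous_d2
    have c3 := h.contDiff₂.continuous_d1
    have c4 := h.contDiff₂.continuous_d2
    fun_prop
  have hconst : ∀ b, ∫ x in (0 : ℝ)..b, K x = -b * Real.exp (-y) := by
    intro b
    have g := hasDerivAt_integral_bilin_d1 dotL h.contDiff₂ h.contDiff₁ 0 b y
    simp only [h.connection₁, h.connection₂, sub_self, add_zero,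
      intervalIntegral.integral_const, sub_zero, smul_eq_mul] at g
    refine g.unique ?_
    rw [show -b * Real.exp (-y) = b * (Real.exp (-y) * -1) by ring]
    exact ((hasDerivAt_neg y).exp).const_mul b
  have d1' : HasDerivAt (fun b => ∫ x in (0 : ℝ)..b, K x) (K x) x :=
    integral_hasDerivAt_right (hKc.intervalIntegrable _ _)
      (hKc.stronglyMeasurableAtFilter _ _) hKc.continuousAt
  simp only [hconst] at d1'
  have d2' := ((hasDerivAt_neg x).mul_const (Real.exp (-y)))
  rw [neg_one_mul] at d2'
  exact d1'.unique d2'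

theorem gauss (h : DarbouxFrame w E₁ E₂) (z : ℝ × ℝ) :
    (Real.exp z.2 * dotL (d1 E₁ z) (crossL (E₁ z) (E₂ z))) *
        dotL (d2 E₂ z) (crossL (E₁ z) (E₂ z)) -
      dotL (d2 E₁ z) (crossL (E₁ z) (E₂ z)) ^ 2 = -1 := by
  have parseval : ∀ a b : Fin 3 → ℝ, dotL a b = dotL a (E₁ z) * dotL b (E₁ z)
      + dotL a (E₂ z) * dotL b (E₂ z)
      + dotL a (crossL (E₁ z) (E₂ z)) * dotL b (crossL (E₁ z) (E₂ z)) := by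
    intro a b
    conv_lhs => rw [eq_orthonormal_expansion (h.inner₁₁ z) (h.inner₁₂ z) (h.inner₂₂ z) b]
    simp only [map_add, map_smul, smul_eq_mul]
    ring
  have hexp : Real.exp (-z.2) * Real.exp z.2 = 1 := by rw [← Real.exp_add]; simp
  have g := h.dotL_d2_d1_sub z
  rw [parseval, parseval (d1 E₂ z), h.symm, h.dotL_d1_self₁, h.dotL_d2_self₂,
    d1_orthogonal_of_unit h.contDiff₂ h.inner₂₂, d2_orthogonal_of_unit h.contDiff₁ h.inner₁₁] at g
  linear_combination Real.exp z.2 * g - hexp +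
    dotL (d2 E₁ z) (crossL (E₁ z) (E₂ z)) ^ 2 * hexp

theorem d1_normal (h : DarbouxFrame w E₁ E₂) (z : ℝ × ℝ) :
    d1 (fun z => crossL (E₁ z) (E₂ z)) z =
      -dotL (d1 E₁ z) (crossL (E₁ z) (E₂ z)) • E₁ z -
        (Real.exp (-z.2) * dotL (d2 E₁ z) (crossL (E₁ z) (E₂ z))) • E₂ z := by
  have o := d1_orthogonal_of_unit h.contDiff_normal h.normal_unit z
  have o1 := dotL_d1_of_const h.contDiff_normal h.contDiff₁ (c := 0)
    (fun z => by rw [dotL_comm, dotL_crossL_self_left]) z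
  have o2 := dotL_d1_of_const h.contDiff_normal h.contDiff₂ (c := 0)
    (fun z => by rw [dotL_comm, dotL_crossL_self_right]) z
  rw [dotL_comm, ← eq_neg_iff_add_eq_zero, eq_comm, neg_eq_iff_eq_neg] at o1 o2
  rw [eq_orthonormal_expansion (h.inner₁₁ z) (h.inner₁₂ z) (h.inner₂₂ z)
    (d1 (fun z => crossL (E₁ z) (E₂ z)) z), o, o1, o2, h.symm]
  module

theorem d2_normal (h : DarbouxFrame w E₁ E₂) (z : ℝ × ℝ) :
    d2 (fun z => crossL (E₁ z) (E₂ z)) z =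
      -dotL (d2 E₁ z) (crossL (E₁ z) (E₂ z)) • E₁ z -
        dotL (d2 E₂ z) (crossL (E₁ z) (E₂ z)) • E₂ z := by
  have o := d2_orthogonal_of_unit h.contDiff_normal h.normal_unit z
  have o1 := dotL_d2_of_const h.contDiff_normal h.contDiff₁ (c := 0)
    (fun z => by rw [dotL_comm, dotL_crossL_self_left]) z
  have o2 := dotL_d2_of_const h.contDiff_normal h.contDiff₂ (c := 0)
    (fun z => by rw [dotL_comm, dotL_crossL_self_right]) z
  rw [dotL_comm, ← eq_neg_iff_add_eq_zero, eq_comm, neg_eq_iff_eq_neg] at o1 o2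
  rw [eq_orthonormal_expansion (h.inner₁₁ z) (h.inner₁₂ z) (h.inner₂₂ z)
    (d2 (fun z => crossL (E₁ z) (E₂ z)) z), o, o1, o2]
  module

theorem crossL_normal₁ (h : DarbouxFrame w E₁ E₂) (z : ℝ × ℝ) :
    crossL (crossL (E₁ z) (E₂ z)) (E₁ z) = E₂ z := by
  rw [crossL_crossL_left, h.inner₁₁, dotL_comm, h.inner₁₂]; simp

theorem crossL_normal₂ (h : DarbouxFrame w E₁ E₂) (z : ℝ × ℝ) :
    crossL (crossL (E₁ z) (E₂ z)) (E₂ z) = -E₁ z := by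
  rw [crossL_crossL_left, h.inner₂₂, h.inner₁₂]; simp

end DarbouxFrame

end Frames

section AsymptoticCoordinates

/-- The angles `α < β < α + π` with the first frame vector of the two asymptotic directions of a
surface with tangent frame `E₁`, `E₂`. -/
structure AsymptoticAngles (E₁ E₂ : ℝ × ℝ → Fin 3 → ℝ) (α β : ℝ × ℝ → ℝ) : Prop where
  continuous_left : Continuous α
  continuous_right : Continuous β
  pos : ∀ z, 0 < β z - α z
  lt_pi : ∀ z, β z - α z < Real.pi
  form₁₁ : ∀ z, Real.exp z.2 * dotL (d1 E₁ z) (crossL (E₁ z) (E₂ z)) * Real.sin (β z - α z) =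
    -2 * Real.sin (α z) * Real.sin (β z)
  form₂₂ : ∀ z, dotL (d2 E₂ z) (crossL (E₁ z) (E₂ z)) * Real.sin (β z - α z) =
    -2 * Real.cos (α z) * Real.cos (β z)
  form₁₂ : ∀ z, dotL (d2 E₁ z) (crossL (E₁ z) (E₂ z)) * Real.sin (β z - α z) =
    Real.sin (α z + β z)

/-- The unit tangent vector at angle `α`. -/
def direction (E₁ E₂ : ℝ × ℝ → Fin 3 → ℝ) (α : ℝ × ℝ → ℝ) (z : ℝ × ℝ) : Fin 3 → ℝ :=
  Real.cos (α z) • E₁ z + Real.sin (α z) • E₂ z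

/-- The first component of the form vanishing on the direction `β` and equal to one on `α`. -/
def dualForm₁ (α β : ℝ × ℝ → ℝ) (z : ℝ × ℝ) : ℝ :=
  Real.sin (β z) * Real.exp (-z.2) / Real.sin (β z - α z)

/-- The second component of the form vanishing on the direction `β` and equal to one on `α`. -/
def dualForm₂ (α β : ℝ × ℝ → ℝ) (z : ℝ × ℝ) : ℝ :=
  -Real.cos (β z) / Real.sin (β z - α z)

variable {w E₁ E₂ : ℝ × ℝ → Fin 3 → ℝ} {α β : ℝ × ℝ → ℝ}

theorem DarbouxFrame.exists_asymptoticAngles (h : DarbouxFrame w E₁ E₂) :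
    ∃ α β, AsymptoticAngles E₁ E₂ α β := by
  have c1 := h.contDiff₁.continuous_d1
  have c2 := h.contDiff₁.continuous_d2
  have c4 := h.contDiff₂.continuous_d2
  have cN := h.contDiff_normal.continuous
  obtain ⟨α, β, hα, hβ, h0, hπ, hz⟩ := exists_asymptotic_angles
    (h₁₁ := fun z => Real.exp z.2 * dotL (d1 E₁ z) (crossL (E₁ z) (E₂ z)))
    (h₁₂ := fun z => dotL (d2 E₁ z) (crossL (E₁ z) (E₂ z)))
    (h₂₂ := fun z => dotL (d2 E₂ z) (crossL (E₁ z) (E₂ z)))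
    (by fun_prop) (by fun_prop) (by fun_prop) h.gauss
  exact ⟨α, β, hα, hβ, h0, hπ, fun z => (hz z).1, fun z => (hz z).2.1, fun z => (hz z).2.2⟩

namespace AsymptoticAngles

theorem sin_pos (a : AsymptoticAngles E₁ E₂ α β) (z : ℝ × ℝ) : 0 < Real.sin (β z - α z) :=
  Real.sin_pos_of_pos_of_lt_pi (a.pos z) (a.lt_pi z)

/-- Reversing the surface exchanges the two asymptotic directions. -/
theorem swap (a : AsymptoticAngles E₁ E₂ α β) :
    AsymptoticAngles (fun z => -E₁ z) (fun z => -E₂ z) β (fun z => α z + Real.pi) := by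
  have e1 : ∀ f : ℝ × ℝ → Fin 3 → ℝ, d1 (fun z => -f z) = fun z => -d1 f z := fun f => by
    ext1 z; simp [d1, fderiv_fun_neg]
  have e2 : ∀ f : ℝ × ℝ → Fin 3 → ℝ, d2 (fun z => -f z) = fun z => -d2 f z := fun f => by
    ext1 z; simp [d2, fderiv_fun_neg]
  have es : ∀ z, Real.sin (α z + Real.pi - β z) = Real.sin (β z - α z) := fun z => by
    rw [← Real.sin_pi_sub]; ring_nf
  refine ⟨a.continuous_right, a.continuous_left.add continuous_const, fun z => ?_, fun z => ?_,
    fun z => ?_, fun z => ?_, fun z => ?_⟩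
  · linarith [a.lt_pi z]
  · linarith [a.pos z]
  · rw [es, Real.sin_add_pi]
    simp only [e1, map_neg, _root_.neg_apply, neg_neg]
    linear_combination -a.form₁₁ z
  · rw [es, Real.cos_add_pi]
    simp only [e2, map_neg, _root_.neg_apply, neg_neg]
    linear_combination -a.form₂₂ z
  · rw [es, ← add_assoc, Real.sin_add_pi, add_comm (β z)]
    simp only [e2, map_neg, _root_.neg_apply, neg_neg]
    linear_combination -a.form₁₂ z

theorem continuous_dualForm₁ (a : AsymptoticAngles E₁ E₂ α β) : Continuous (dualForm₁ α β) := by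
  have h1 := a.continuous_left
  have h2 := a.continuous_right
  unfold dualForm₁
  exact Continuous.div (by fun_prop) (by fun_prop) fun z => (a.sin_pos z).ne'

theorem continuous_dualForm₂ (a : AsymptoticAngles E₁ E₂ α β) : Continuous (dualForm₂ α β) := by
  have h1 := a.continuous_left
  have h2 := a.continuous_right
  unfold dualForm₂
  exact Continuous.div (by fun_prop) (by fun_prop) fun z => (a.sin_pos z).ne'

theorem dualForm_left (a : AsymptoticAngles E₁ E₂ α β) (z : ℝ × ℝ) :
    Real.exp z.2 * Real.cos (α z) * dualForm₁ α β z + Real.sin (α z) * dualForm₂ α β z = 1 := by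
  have hs := (a.sin_pos z).ne'
  have hexp : Real.exp (-z.2) * Real.exp z.2 = 1 := by rw [← Real.exp_add]; simp
  unfold dualForm₁ dualForm₂
  field_simp
  rw [Real.sin_sub]
  linear_combination Real.cos (α z) * Real.sin (β z) * hexp

theorem dualForm_right (z : ℝ × ℝ) :
    Real.exp z.2 * Real.cos (β z) * dualForm₁ α β z + Real.sin (β z) * dualForm₂ α β z = 0 := by
  have hexp : Real.exp (-z.2) * Real.exp z.2 = 1 := by rw [← Real.exp_add]; simp
  unfold dualForm₁ dualForm₂
  linear_combination Real.cos (β z) * Real.sin (β z) / Real.sin (β z - α z) * hexp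

theorem continuous_direction (h : DarbouxFrame w E₁ E₂) (a : AsymptoticAngles E₁ E₂ α β) :
    Continuous (direction E₁ E₂ α) := by
  have h1 := a.continuous_left
  have h2 := h.contDiff₁.continuous
  have h3 := h.contDiff₂.continuous
  unfold direction
  fun_prop

theorem d1_add_crossL (h : DarbouxFrame w E₁ E₂) (a : AsymptoticAngles E₁ E₂ α β) (z : ℝ × ℝ) :
    d1 w z + crossL (crossL (E₁ z) (E₂ z)) (d1 (fun z => crossL (E₁ z) (E₂ z)) z) =
      (2 * dualForm₁ α β z) • direction E₁ E₂ α z := by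
  have hs := (a.sin_pos z).ne'
  have hexp : Real.exp (-z.2) * Real.exp z.2 = 1 := by rw [← Real.exp_add]; simp
  rw [h.d1_normal, h.d1_eq, map_sub, map_smul, map_smul, h.crossL_normal₁, h.crossL_normal₂]
  have e1 : dotL (d1 E₁ z) (crossL (E₁ z) (E₂ z)) =
      -2 * Real.sin (α z) * dualForm₁ α β z := by
    unfold dualForm₁
    field_simp
    linear_combination Real.exp (-z.2) * a.form₁₁ z -
      dotL (d1 E₁ z) (crossL (E₁ z) (E₂ z)) * Real.sin (β z - α z) * hexp
  have e2 : Real.exp (-z.2) + Real.exp (-z.2) * dotL (d2 E₁ z) (crossL (E₁ z) (E₂ z)) =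
      2 * Real.cos (α z) * dualForm₁ α β z := by
    unfold dualForm₁
    field_simp
    have := a.form₁₂ z
    rw [Real.sin_add] at this
    have k := Real.sin_sub (β z) (α z)
    linear_combination this + k
  rw [direction, e1]
  linear_combination (norm := module) e2 • E₁ z

theorem d2_add_crossL (h : DarbouxFrame w E₁ E₂) (a : AsymptoticAngles E₁ E₂ α β) (z : ℝ × ℝ) :
    d2 w z + crossL (crossL (E₁ z) (E₂ z)) (d2 (fun z => crossL (E₁ z) (E₂ z)) z) =
      (2 * dualForm₂ α β z) • direction E₁ E₂ α z := by
  have hs := (a.sin_pos z).ne'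
  rw [h.d2_normal, h.d2_eq, map_sub, map_smul, map_smul, h.crossL_normal₁, h.crossL_normal₂]
  have e1 : dotL (d2 E₂ z) (crossL (E₁ z) (E₂ z)) = 2 * Real.cos (α z) * dualForm₂ α β z := by
    unfold dualForm₂
    field_simp
    linear_combination a.form₂₂ z
  have e2 : 1 - dotL (d2 E₁ z) (crossL (E₁ z) (E₂ z)) = 2 * Real.sin (α z) * dualForm₂ α β z := by
    unfold dualForm₂
    field_simp
    have := a.form₁₂ z
    rw [Real.sin_add] at this
    have k := Real.sin_sub (β z) (α z)
    linear_combination -this + k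
  rw [direction, e1]
  linear_combination (norm := module) e2 • E₂ z

theorem dotL_direction_self (h : DarbouxFrame w E₁ E₂) (z : ℝ × ℝ) :
    dotL (direction E₁ E₂ α z) (direction E₁ E₂ α z) = 1 := by
  simp only [direction, map_add, map_smul, _root_.add_apply, _root_.smul_apply, smul_eq_mul,
    h.inner₁₁, h.inner₁₂, h.inner₂₂, dotL_comm (E₂ z) (E₁ z)]
  linear_combination Real.sin_sq_add_cos_sq (α z)

theorem dotL_direction_normal (z : ℝ × ℝ) :
    dotL (direction E₁ E₂ α z) (crossL (E₁ z) (E₂ z)) = 0 := by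
  simp [direction, dotL_crossL_self_left, dotL_crossL_self_right]

theorem exists_primitive (h : DarbouxFrame w E₁ E₂) (a : AsymptoticAngles E₁ E₂ α β) :
    ∃ s : ℝ × ℝ → ℝ, ∀ z, HasFDerivAt s (covec (dualForm₁ α β z) (dualForm₂ α β z)) z := by
  refine exists_global_primitive a.continuous_dualForm₁ a.continuous_dualForm₂
    (exists_local_primitive h.contDiff h.contDiff_normal (a.continuous_direction h)
      (a.d1_add_crossL h) (a.d2_add_crossL h)
      (dotL_direction_self h) dotL_direction_normal h.normal_unit fun z hz => ?_)
  rw [h.d1_eq, h.d2_eq] at hz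
  have hs := (a.sin_pos z).ne'
  have hz1 := congrArg (dotL (E₁ z)) hz
  have hz2 := congrArg (dotL (E₂ z)) hz
  simp [h.inner₁₁, h.inner₁₂, h.inner₂₂, dotL_comm (E₂ z) (E₁ z), dualForm₁, dualForm₂, hs]
    at hz1 hz2
  have := Real.sin_sq_add_cos_sq (β z)
  rw [hz1, hz2] at this
  norm_num at this

end AsymptoticAngles

/-- Global coordinates on the plane whose coordinate curves are the asymptotic curves, parametrized
by arc length. -/
theorem AsymptoticAngles.exists_chart (h : DarbouxFrame w E₁ E₂)
    (a : AsymptoticAngles E₁ E₂ α β) :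
    ∃ G : ℝ × ℝ → ℝ × ℝ, ContDiff ℝ 1 G ∧
      (∀ y, d1 G y = (Real.exp (G y).2 * Real.cos (α (G y)), Real.sin (α (G y)))) ∧
      ∀ y, d2 G y = (Real.exp (G y).2 * Real.cos (β (G y)), Real.sin (β (G y))) := by
  obtain ⟨s, hs⟩ := a.exists_primitive h
  obtain ⟨t, ht⟩ := a.swap.exists_primitive h.neg
  set F : ℝ × ℝ → ℝ × ℝ := fun z => (s z - s 0, t z - t 0) with hF
  set p := dualForm₁ α β with hp
  set q := dualForm₂ α β with hq
  set p' := dualForm₁ β (fun z => α z + Real.pi) with hp'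
  set q' := dualForm₂ β (fun z => α z + Real.pi) with hq'
  have hd : ∀ z, HasFDerivAt F ((covec (p z) (q z)).prod (covec (p' z) (q' z))) z :=
    fun z => ((hs z).sub_const _).prodMk ((ht z).sub_const _)
  have hFc : ContDiff ℝ 1 F := by
    refine contDiff_one_of_hasFDerivAt hd ?_
    have k1 := a.continuous_dualForm₁.covec a.continuous_dualForm₂
    have k2 := a.swap.continuous_dualForm₁.covec a.swap.continuous_dualForm₂
    exact (ContinuousLinearMap.prodₗᵢ ℝ).continuous.comp (k1.prodMk k2)
  have hα := a.continuous_left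
  have hβ := a.continuous_right
  have hbound : ∀ (z : ℝ × ℝ) (c : ℝ), |Real.exp z.2 * Real.cos c| ≤ Real.exp z.2 := by
    intro z c
    rw [abs_mul, abs_of_pos (Real.exp_pos _)]
    exact mul_le_of_le_one_right (Real.exp_pos _).le (Real.abs_cos_le_one c)
  refine exists_global_chart (F := F)
    (A := fun z => (Real.exp z.2 * Real.cos (α z), Real.sin (α z)))
    (B := fun z => (Real.exp z.2 * Real.cos (β z), Real.sin (β z)))
    hFc (by simp [hF]) (by fun_prop) (by fun_prop) (fun z => ?_) (fun z => ?_)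
    (fun z => hbound z _) (fun z => Real.abs_sin_le_one _)
    (fun z => hbound z _) (fun z => Real.abs_sin_le_one _)
  · have h1 := a.dualForm_left z
    have h2 := dualForm_right (α := β) (β := fun z => α z + Real.pi) z
    rw [Real.cos_add_pi, Real.sin_add_pi] at h2
    rw [(hd z).fderiv]
    refine Prod.ext ?_ ?_
    · simpa using h1
    · simp
      linear_combination -h2
  · have h1 := dualForm_right (α := α) (β := β) z
    have h2 := a.swap.dualForm_left z
    rw [(hd z).fderiv]
    refine Prod.ext ?_ ?_
    · simpa using h1
    · simpa using h2

end AsymptoticCoordinates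

section AngleEquations

theorem hasDerivAt_of_hasDerivAt_integral {V : Type*} [NormedAddCommGroup V] [NormedSpace ℝ V]
    [CompleteSpace V] {f g : ℝ × ℝ → V} (hf : Continuous f) (hg : Continuous g)
    (h : ∀ a b y, HasDerivAt (fun y => ∫ x in a..b, f (x, y)) (∫ x in a..b, g (x, y)) y)
    (x y : ℝ) : HasDerivAt (fun y => f (x, y)) (g (x, y)) y := by
  have key : ∀ t, f (x, t) - f (x, y) = ∫ τ in y..t, g (x, τ) := by
    intro t
    have hconst : ∀ b, ∫ x in (0 : ℝ)..b, (f (x, t) - f (x, y)) =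
        ∫ x in (0 : ℝ)..b, ∫ τ in y..t, g (x, τ) := by
      intro b
      rw [intervalIntegral.integral_sub (Continuous.intervalIntegrable (by fun_prop) _ _)
        (Continuous.intervalIntegrable (by fun_prop) _ _),
        integral_swap_of_continuous (f := fun x τ => g (x, τ)) hg]
      refine (integral_eq_sub_of_hasDerivAt (fun τ _ => h 0 b τ) ?_).symm
      refine Continuous.intervalIntegrable ?_ _ _
      exact continuous_parametric_intervalIntegral_of_continuous' (f := fun τ x => g (x, τ))
        (by fun_prop) 0 b
    have c1 : Continuous fun x => f (x, t) - f (x, y) := by fun_prop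
    have c2 : Continuous fun x => ∫ τ in y..t, g (x, τ) :=
      continuous_parametric_intervalIntegral_of_continuous' (f := fun x τ => g (x, τ))
        (by fun_prop) y t
    have k1 := integral_hasDerivAt_right (c1.intervalIntegrable 0 x)
      (c1.stronglyMeasurableAtFilter _ _) c1.continuousAt
    have k2 := integral_hasDerivAt_right (c2.intervalIntegrable 0 x)
      (c2.stronglyMeasurableAtFilter _ _) c2.continuousAt
    simp only [hconst] at k1
    exact k1.unique k2
  have c3 : Continuous fun τ => g (x, τ) := by fun_prop
  have k := (integral_hasDerivAt_right (c3.intervalIntegrable y y)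
    (c3.stronglyMeasurableAtFilter _ _) c3.continuousAt).const_add (f (x, y))
  refine k.congr_of_eventuallyEq (Eventually.of_forall fun t => ?_)
  simp only
  rw [← key t]
  abel

/-- The derivative of a continuous angle from those of its sine and cosine. -/
theorem hasDerivAt_angle {α : ℝ → ℝ} {k t : ℝ} (hα : ContinuousAt α t)
    (hc : HasDerivAt (fun t => Real.cos (α t)) (-Real.sin (α t) * k) t)
    (hs : HasDerivAt (fun t => Real.sin (α t)) (Real.cos (α t) * k) t) : HasDerivAt α k t := by
  have hS : HasDerivAt (fun τ => Real.sin (α τ - α t)) k t := by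
    simp only [Real.sin_sub]
    have := (hs.mul_const (Real.cos (α t))).sub (hc.mul_const (Real.sin (α t)))
    rwa [show Real.cos (α t) * k * Real.cos (α t) - -Real.sin (α t) * k * Real.sin (α t) = k by
      linear_combination k * Real.sin_sq_add_cos_sq (α t)] at this
  have hA : HasDerivAt (fun τ => Real.arcsin (Real.sin (α τ - α t))) k t := by
    have h1 : HasDerivAt Real.arcsin 1 (Real.sin (α t - α t)) := by
      simpa using Real.hasDerivAt_arcsin (x := 0) (by norm_num) (by norm_num)
    have h2 := HasDerivAt.comp t h1 hS
    rw [one_mul] at h2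
    exact h2
  refine (hA.const_add (α t)).congr_of_eventuallyEq ?_
  have hmem : Ioo (α t - Real.pi / 2) (α t + Real.pi / 2) ∈ 𝓝 (α t) :=
    Ioo_mem_nhds (by linarith [Real.pi_pos]) (by linarith [Real.pi_pos])
  filter_upwards [hα hmem] with τ hτ
  rw [Real.arcsin_sin (by linarith [hτ.1]) (by linarith [hτ.2])]
  ring

variable {w E₁ E₂ : ℝ × ℝ → Fin 3 → ℝ} {α β : ℝ × ℝ → ℝ} {G : ℝ × ℝ → ℝ × ℝ}

theorem AsymptoticAngles.hasDerivAt_left (h : DarbouxFrame w E₁ E₂)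
    (a : AsymptoticAngles E₁ E₂ α β) (hG : ContDiff ℝ 1 G)
    (hG1 : ∀ y, d1 G y = (Real.exp (G y).2 * Real.cos (α (G y)), Real.sin (α (G y))))
    (hG2 : ∀ y, d2 G y = (Real.exp (G y).2 * Real.cos (β (G y)), Real.sin (β (G y))))
    (s t : ℝ) : HasDerivAt (fun t => α (G (s, t))) (-Real.cos (β (G (s, t)))) t := by
  set N : ℝ × ℝ → Fin 3 → ℝ := fun z => crossL (E₁ z) (E₂ z) with hN
  have hwG : ContDiff ℝ 1 fun y => w (G y) := h.contDiff.comp hG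
  have hNG : ContDiff ℝ 1 fun y => N (G y) := h.contDiff_normal.comp hG
  have h1G : ContDiff ℝ 1 fun y => E₁ (G y) := h.contDiff₁.comp hG
  have h2G : ContDiff ℝ 1 fun y => E₂ (G y) := h.contDiff₂.comp hG
  have hcomp := asymptotic_comp h.contDiff h.contDiff_normal hG (a.d1_add_crossL h)
    (a.d2_add_crossL h)
  have k1 : ∀ y, d1 (fun y => w (G y)) y + crossL (N (G y)) (d1 (fun y => N (G y)) y) =
      (2 : ℝ) • direction E₁ E₂ α (G y) := by
    intro y
    have := hcomp y (1, 0)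
    change _ = (2 * ((d1 G y).1 * _ + (d1 G y).2 * _)) • _ at this
    rw [hG1] at this
    simp only [a.dualForm_left, mul_one] at this
    exact this
  have k2 : ∀ y, d2 (fun y => w (G y)) y + crossL (N (G y)) (d2 (fun y => N (G y)) y) = 0 := by
    intro y
    have := hcomp y (0, 1)
    change _ = (2 * ((d2 G y).1 * _ + (d2 G y).2 * _)) • _ at this
    rw [hG2] at this
    simp only [dualForm_right, mul_zero, zero_smul] at this
    exact this
  set Z : ℝ × ℝ → Fin 3 → ℝ := fun y =>
    -crossL (d1 (fun y => N (G y)) y) (d2 (fun y => N (G y)) y) with hZ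
  have hX : HasDerivAt (fun t => direction E₁ E₂ α (G (s, t))) (Z (s, t)) t := by
    refine hasDerivAt_of_hasDerivAt_integral (f := fun y => direction E₁ E₂ α (G y)) (g := Z)
      ((a.continuous_direction h).comp hG.continuous) ?_ (fun x₁ x₂ y => ?_) s t
    · have c1 := hNG.continuous_d1
      have c2 := hNG.continuous_d2
      fun_prop
    · have := hasDerivAt_integral_asymptotic hwG hNG x₁ x₂ y
      simpa only [k1, k2, smul_smul, one_div, inv_mul_cancel₀ (two_ne_zero' ℝ), one_smul,
        smul_zero, sub_zero, add_zero] using this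
  have hNN : ∀ y, dotL (N (G y)) (N (G y)) = 1 := fun y => h.normal_unit _
  have orth : ∀ v, dotL v (N (G (s, t))) = 0 → dotL (Z (s, t)) v = 0 := by
    intro v hv
    rw [dotL_comm, hZ, map_neg, triple_eq_zero_of_orthogonal (hNN (s, t)) hv
      (d1_orthogonal_of_unit hNG hNN _) (d2_orthogonal_of_unit hNG hNN _), neg_zero]
  have hE : ∀ f : ℝ × ℝ → Fin 3 → ℝ, ContDiff ℝ 1 f → d2 (fun y => f (G y)) (s, t) =
      (Real.exp (G (s, t)).2 * Real.cos (β (G (s, t)))) • d1 f (G (s, t)) +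
        Real.sin (β (G (s, t))) • d2 f (G (s, t)) := by
    intro f hf
    have := fderiv_comp_plane hf hG (s, t) (0, 1)
    change _ = (d2 G (s, t)).1 • _ + (d2 G (s, t)).2 • _ at this
    rwa [hG2] at this
  have hd1 := hX.dotL (h1G.hasDerivAt_d2 s t)
  have hd2 := hX.dotL (h2G.hasDerivAt_d2 s t)
  rw [orth _ (dotL_crossL_self_left _ _), add_zero, hE _ h.contDiff₁] at hd1
  rw [orth _ (dotL_crossL_self_right _ _), add_zero, hE _ h.contDiff₂] at hd2
  have hexp : Real.exp (-(G (s, t)).2) * Real.exp (G (s, t)).2 = 1 := by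
    rw [← Real.exp_add]; simp
  set z := G (s, t) with hz
  have o11 : dotL (E₁ z) (d1 E₁ z) = 0 := by rw [dotL_comm]; exact h.dotL_d1_self₁ z
  have o12 : dotL (E₁ z) (d2 E₁ z) = 0 := by
    rw [dotL_comm]; exact d2_orthogonal_of_unit h.contDiff₁ h.inner₁₁ z
  have o21 : dotL (E₂ z) (d1 E₂ z) = 0 := by
    rw [dotL_comm]; exact d1_orthogonal_of_unit h.contDiff₂ h.inner₂₂ z
  have o22 : dotL (E₂ z) (d2 E₂ z) = 0 := by rw [dotL_comm]; exact h.dotL_d2_self₂ z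
  have x1 : dotL (E₁ z) (d1 E₂ z) = -Real.exp (-z.2) := by
    have := dotL_d1_of_const h.contDiff₁ h.contDiff₂ h.inner₁₂ z
    rw [dotL_comm (d1 E₁ z), h.connection₁] at this
    linarith
  have x2 : dotL (E₁ z) (d2 E₂ z) = 0 := by
    have := dotL_d2_of_const h.contDiff₁ h.contDiff₂ h.inner₁₂ z
    rw [dotL_comm (d2 E₁ z), h.connection₂] at this
    linarith
  refine hasDerivAt_angle ?_ ?_ ?_
  · exact (a.continuous_left.comp (hG.continuous.comp (Continuous.prodMk_right s))).continuousAt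
  · convert hd1 using 1
    · ext τ
      simp [direction, h.inner₁₁, h.inner₁₂, dotL_comm (E₂ _) (E₁ _)]
    · simp only [direction, map_add, map_smul, _root_.add_apply, _root_.smul_apply, smul_eq_mul,
        o11, o12, h.connection₁, h.connection₂]
      linear_combination -Real.sin (α z) * Real.cos (β z) * hexp
  · convert hd2 using 1
    · ext τ
      simp [direction, h.inner₂₂, h.inner₁₂]
    · simp only [direction, map_add, map_smul, _root_.add_apply, _root_.smul_apply, smul_eq_mul,
        o21, o22, x1, x2]
      linear_combination Real.cos (α z) * Real.cos (β z) * hexp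

/-- No surface in space carries a global Darboux frame of the hyperbolic plane. -/
theorem DarbouxFrame.false (h : DarbouxFrame w E₁ E₂) : False := by
  obtain ⟨α, β, a⟩ := h.exists_asymptoticAngles
  obtain ⟨G, hG, hG1, hG2⟩ := a.exists_chart h
  have hGd : ∀ y, HasFDerivAt G (fderiv ℝ G y) y := hG.hasFDerivAt_one
  set R : ℝ × ℝ → ℝ × ℝ := fun y => G (-y.2, y.1) with hR
  have hRc : ContDiff ℝ 1 R := hG.comp (contDiff_snd.neg.prodMk contDiff_fst)
  have hL : ∀ y, HasFDerivAt (fun y : ℝ × ℝ => (-y.2, y.1))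
      ((-ContinuousLinearMap.snd ℝ ℝ ℝ).prod (ContinuousLinearMap.fst ℝ ℝ ℝ)) y :=
    fun y => hasFDerivAt_snd.neg.prodMk hasFDerivAt_fst
  have hRd : ∀ y v, fderiv ℝ R y v = fderiv ℝ G (-y.2, y.1) (-v.2, v.1) := by
    intro y v
    have hc : HasFDerivAt R _ y := (hGd (-y.2, y.1)).comp y (hL y)
    rw [hc.fderiv]
    simp
  have hR1 : ∀ y, d1 R y = (Real.exp (R y).2 * Real.cos (β (R y)), Real.sin (β (R y))) := by
    intro y
    rw [d1, hRd]
    simpa [d2] using hG2 (-y.2, y.1)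
  have hR2 : ∀ y, d2 R y = (Real.exp (R y).2 * Real.cos (α (R y) + Real.pi),
      Real.sin (α (R y) + Real.pi)) := by
    intro y
    have := congrArg Neg.neg (hG1 (-y.2, y.1))
    rw [d1, ← map_neg] at this
    rw [d2, hRd, Real.cos_add_pi, Real.sin_add_pi]
    simpa using this
  have hα := a.hasDerivAt_left h hG hG1 hG2
  have hβ := a.swap.hasDerivAt_left h.neg hRc hR1 hR2
  refine no_global_chebyshev_angles (α := fun y => α (G y)) (β := fun y => β (G y))
    (a.continuous_left.comp hG.continuous) (a.continuous_right.comp hG.continuous) hα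
    (fun s t => ?_) (fun z => a.pos _) (fun z => a.lt_pi _)
  have k := HasDerivAt.scomp s (hβ t (-s)) (hasDerivAt_neg s)
  simpa [hR, Function.comp_def] using k

end AngleEquations

section HalfPlane

/-- The half-plane point `(x, e^v)`. -/
def logChart (z : ℝ × ℝ) : E2 := !₂[z.1, Real.exp z.2]

theorem hasFDerivAt_logChart (z : ℝ × ℝ) : HasFDerivAt logChart
    (covec (EuclideanSpace.single 0 1) (Real.exp z.2 • EuclideanSpace.single 1 1)) z := by
  rw [← hasFDerivWithinAt_univ, hasFDerivWithinAt_euclidean]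
  intro i
  rw [hasFDerivWithinAt_univ]
  fin_cases i
  · exact (hasFDerivAt_fst : HasFDerivAt (fun z : ℝ × ℝ => z.1) _ z).congr_fderiv
      (ContinuousLinearMap.ext fun v => by simp [covec_apply])
  · exact (hasFDerivAt_snd : HasFDerivAt (fun z : ℝ × ℝ => z.2) _ z).exp.congr_fderiv
      (ContinuousLinearMap.ext fun v => by simp [covec_apply, mul_comm])

theorem contDiff_logChart : ContDiff ℝ 2 logChart := by
  rw [contDiff_euclidean]
  intro i
  fin_cases i
  · exact contDiff_fst
  · exact Real.contDiff_exp.comp contDiff_snd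

theorem logChart_mem (z : ℝ × ℝ) : logChart z ∈ upperHalfPlane := by
  simpa [logChart, upperHalfPlane] using Real.exp_pos z.2

theorem isOpen_upperHalfPlane : IsOpen upperHalfPlane :=
  isOpen_lt continuous_const (by fun_prop)

theorem dotL_fderiv_eq {u : E2 → EuclideanSpace ℝ (Fin 3)} {p : E2}
    (h : (Jac u p)ᵀ * Jac u p = hyperbolicMetric p) (j k : Fin 2) :
    dotL (WithLp.ofLp (fderiv ℝ u p (EuclideanSpace.single j 1)))
      (WithLp.ofLp (fderiv ℝ u p (EuclideanSpace.single k 1))) =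
      if j = k then ((p 1) ^ 2)⁻¹ else 0 := by
  have := congrFun (congrFun h j) k
  simpa [Matrix.mul_apply, Jac, hyperbolicMetric, Fin.sum_univ_three, dotL_apply,
    Matrix.one_apply] using this

end HalfPlane

/-- **Hilbert's theorem.** The full hyperbolic plane admits no `C²` isometric
immersion in `ℝ³`. -/
theorem hilbert_no_isometric_immersion :
    ¬ ∃ u : E2 → EuclideanSpace ℝ (Fin 3),
      ContDiffOn ℝ 2 u upperHalfPlane ∧
      ∀ p ∈ upperHalfPlane, (Jac u p)ᵀ * Jac u p = hyperbolicMetric p := by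
  rintro ⟨u, hu, hg⟩
  set w : ℝ × ℝ → Fin 3 → ℝ := fun z => EuclideanSpace.equiv (Fin 3) ℝ (u (logChart z)) with hw
  have hwc : ContDiff ℝ 2 w := (EuclideanSpace.equiv (Fin 3) ℝ).contDiff.comp
    (hu.comp_contDiff contDiff_logChart logChart_mem)
  have hwd : ∀ z, HasFDerivAt w ((EuclideanSpace.equiv (Fin 3) ℝ : _ →L[ℝ] _) ∘L
      (fderiv ℝ u (logChart z) ∘L
        covec (EuclideanSpace.single 0 1) (Real.exp z.2 • EuclideanSpace.single 1 1))) z := by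
    intro z
    have hd : HasFDerivAt u (fderiv ℝ u (logChart z)) (logChart z) :=
      ((hu.contDiffAt (isOpen_upperHalfPlane.mem_nhds (logChart_mem z))).differentiableAt
        two_ne_zero).hasFDerivAt
    exact (EuclideanSpace.equiv (Fin 3) ℝ).hasFDerivAt.comp z
      (hd.comp z (hasFDerivAt_logChart z))
  have h1 : ∀ z, d1 w z =
      WithLp.ofLp (fderiv ℝ u (logChart z) (EuclideanSpace.single 0 1)) := fun z => by
    rw [d1, (hwd z).fderiv]
    simp
    rfl
  have h2 : ∀ z, d2 w z =
      Real.exp z.2 • WithLp.ofLp (fderiv ℝ u (logChart z) (EuclideanSpace.single 1 1)) :=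
    fun z => by
      rw [d2, (hwd z).fderiv]
      simp
      rfl
  have hI := fun z => dotL_fderiv_eq (hg _ (logChart_mem z))
  have hy : ∀ z, logChart z 1 = Real.exp z.2 := fun z => by simp [logChart]
  obtain ⟨E₁, E₂, h⟩ := exists_darbouxFrame hwc
    (fun z => by simp [h1, hI, hy, Real.exp_neg])
    (fun z => by simp [h1, h2, hI])
    (fun z => by
      have := Real.exp_ne_zero z.2
      simp only [h2, map_smul, _root_.smul_apply, smul_eq_mul, hI, hy, if_true]
      field_simp)
  exact h.false
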